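/- arXiv:2002.08644 — 2 statements merged into one kernel-verified Lean document; each statement's English description precedes it below -/
import Mathlib

section
/- A bounded domain Ω ⊆ ℂ is simply connected at the boundary if and only if Ω is a generalized Jordan domain. -/
open Set Metric Filter MeasureTheory Topology

noncomputable section

/-- A planar domain: a nonempty open connected subset of ℂ. -/
def IsPlanarDomain (D : Set ℂ) : Prop := D.Nonempty ∧ IsOpen D ∧ IsConnected D

/-- A Peano compactum: a compact subset of ℂ all of whose connected components are
locally connected (as subspaces of ℂ) and such that for every `C > 0` only finitely
many components have diameter greater than `C`. -/
def IsPeanoCompactum (K : Set ℂ) : Prop :=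
  IsCompact K ∧
  (∀ x ∈ K, LocallyConnectedSpace ↥(connectedComponentIn K x)) ∧
  ∀ C : ℝ, 0 < C →
    {Q : Set ℂ | (∃ x ∈ K, Q = connectedComponentIn K x) ∧ C < Metric.diam Q}.Finite

/-- A Jordan curve: a subset of ℂ homeomorphic to the unit circle. -/
def IsJordanCurve (J : Set ℂ) : Prop :=
  Nonempty (↥J ≃ₜ ↥(Metric.sphere (0:ℂ) 1))

/-- A generalized Jordan domain: a bounded domain whose boundary is a Peano compactum,
each of whose boundary components is a single point or a Jordan curve. -/
def IsGeneralizedJordanDomain (D : Set ℂ) : Prop :=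
  IsPlanarDomain D ∧ Bornology.IsBounded D ∧
  IsPeanoCompactum (frontier D) ∧
  ∀ x ∈ frontier D,
    connectedComponentIn (frontier D) x = {x} ∨
    IsJordanCurve (connectedComponentIn (frontier D) x)

/-- `φ` restricts to a homeomorphism of `D` onto `Ω`. -/
def IsHomeoOnto (φ : ℂ → ℂ) (D Ω : Set ℂ) : Prop :=
  ContinuousOn φ D ∧ Set.BijOn φ D Ω ∧
  ∃ ψ : ℂ → ℂ, ContinuousOn ψ Ω ∧ Set.InvOn ψ φ D Ω

/-- `φ` is a conformal homeomorphism (holomorphic bijection) of `D` onto `Ω`. -/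
def IsConformalHomeoOnto (φ : ℂ → ℂ) (D Ω : Set ℂ) : Prop :=
  DifferentiableOn ℂ φ D ∧ Set.BijOn φ D Ω

/-- `φb` is a continuous extension of `φ : D → Ω` to `closure D`, with values in `closure Ω`. -/
def ExtendsContinuously (φ φb : ℂ → ℂ) (D Ω : Set ℂ) : Prop :=
  ContinuousOn φb (closure D) ∧ Set.EqOn φb φ D ∧ Set.MapsTo φb (closure D) (closure Ω)

/-- The oscDiam `σ_r(z₀) = diam φ(D ∩ C_r(z₀))`. -/
def oscDiam (φ : ℂ → ℂ) (D : Set ℂ) (z₀ : ℂ) (r : ℝ) : ℝ :=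
  Metric.diam (φ '' (D ∩ Metric.sphere z₀ r))

/-- `liminf_{r→0⁺} σ_r(z₀) = 0`. -/
def OscLiminfZero (φ : ℂ → ℂ) (D : Set ℂ) (z₀ : ℂ) : Prop :=
  Filter.liminf (oscDiam φ D z₀) (nhdsWithin (0:ℝ) (Set.Ioi 0)) = 0

/-- A circle domain (normalized so that ∞ lies in a complementary disk): every bounded
complementary component is a point or a closed round disk, and the unbounded
complementary component is the complement of an open round disk. -/
def IsCircleDomain (D : Set ℂ) : Prop :=
  IsPlanarDomain D ∧ Bornology.IsBounded D ∧
  ∀ x ∈ Dᶜ,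
    (Bornology.IsBounded (connectedComponentIn Dᶜ x) →
      connectedComponentIn Dᶜ x = {x} ∨
      ∃ c : ℂ, ∃ rad : ℝ, 0 < rad ∧ connectedComponentIn Dᶜ x = Metric.closedBall c rad) ∧
    (¬ Bornology.IsBounded (connectedComponentIn Dᶜ x) →
      ∃ c : ℂ, ∃ rad : ℝ, 0 < rad ∧ connectedComponentIn Dᶜ x = (Metric.ball c rad)ᶜ)

/-- A set has σ-finite linear (1-dimensional Hausdorff) measure. -/
def SigmaFiniteH1 (E : Set ℂ) : Prop :=
  ∃ f : ℕ → Set ℂ, (⋃ n, f n) = E ∧ ∀ n, μH[1] (f n) < ⊤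

/-- The set of connected components of `K` containing more than one point. -/
def NondegComponents (K : Set ℂ) : Set (Set ℂ) :=
  {Q | (∃ x ∈ K, Q = connectedComponentIn K x) ∧ ∃ a ∈ Q, ∃ b ∈ Q, a ≠ b}

/-- The union of the singleton connected components of `K`. -/
def SingletonPart (K : Set ℂ) : Set ℂ :=
  {x | x ∈ K ∧ connectedComponentIn K x = {x}}

/-- The cluster set `C(h, z₀) = ⋂_{r>0} closure h({z ∈ U : |z − z₀| < r})`. -/
def clusterSet (h : ℂ → ℂ) (U : Set ℂ) (z₀ : ℂ) : Set ℂ :=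
  ⋂ r ∈ Set.Ioi (0:ℝ), closure (h '' (U ∩ Metric.ball z₀ r))

/-- The boundary component of `Ω` corresponding (under `φ : D → Ω`) to a boundary
component `Q` of `D`: `φ^B(Q) = ⋃_{z ∈ Q} C(φ, z)`. -/
def boundaryComp (φ : ℂ → ℂ) (D : Set ℂ) (Q : Set ℂ) : Set ℂ :=
  ⋃ z ∈ Q, clusterSet φ D z

/-- An arc: the image of a continuous injective map from `[0,1]`. -/
def IsArc (A : Set ℂ) : Prop :=
  ∃ f : ℝ → ℂ, ContinuousOn f (Set.Icc 0 1) ∧ Set.InjOn f (Set.Icc 0 1) ∧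
    f '' Set.Icc 0 1 = A

/-- An arc from `a` to `b`. -/
def IsArcFromTo (A : Set ℂ) (a b : ℂ) : Prop :=
  ∃ f : ℝ → ℂ, ContinuousOn f (Set.Icc 0 1) ∧ Set.InjOn f (Set.Icc 0 1) ∧
    f '' Set.Icc 0 1 = A ∧ f 0 = a ∧ f 1 = b

/-- Property S: for every `ε > 0`, `Ω` is a finite union of connected sets of diameter `< ε`. -/
def PropertyS (Ω : Set ℂ) : Prop :=
  ∀ ε > (0:ℝ), ∃ (k : ℕ) (N : Fin k → Set ℂ),
    (∀ i, IsConnected (N i) ∧ Metric.diam (N i) < ε) ∧ (⋃ i, N i) = Ω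

/-- `x ∈ ∂Ω` is locally accessible from `Ω`. -/
def LocallyAccessible (Ω : Set ℂ) (x : ℂ) : Prop :=
  ∀ ε > (0:ℝ), ∃ δ > (0:ℝ), ∀ z ∈ Ω, dist z x < δ →
    ∃ A : Set ℂ, IsArcFromTo A z x ∧ A ⊆ Ω ∪ {x} ∧ Metric.diam A < ε

/-- `ξ ∈ ∂Ω` is locally sequentially accessible. -/
def LocallySeqAccessible (Ω : Set ℂ) (ξ : ℂ) : Prop :=
  ∀ r > (0:ℝ), ∀ ξn : ℕ → ℂ, (∀ n, ξn n ∈ Ω) → Filter.Tendsto ξn Filter.atTop (nhds ξ) →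
    ∃ x ∈ Ω ∩ Metric.ball ξ r,
      {n : ℕ | ξn n ∈ connectedComponentIn (Ω ∩ Metric.ball ξ r) x}.Infinite

/-- `Ω` is finitely connected at the boundary point `x`. -/
def FinitelyConnectedAt (Ω : Set ℂ) (x : ℂ) : Prop :=
  ∀ r > (0:ℝ), ∃ U : Set ℂ, IsOpen U ∧ x ∈ U ∧ U ⊆ Metric.ball x r ∧
    {Q : Set ℂ | ∃ y ∈ U ∩ Ω, Q = connectedComponentIn (U ∩ Ω) y}.Finite

/-- The diameter (Mazurkiewicz) distance on `Ω`. -/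
def mazDist (Ω : Set ℂ) (x y : ℂ) : ℝ :=
  sInf (Metric.diam '' {E : Set ℂ | E ⊆ Ω ∧ IsConnected E ∧ x ∈ E ∧ y ∈ E})

/-- `Ω` is totally bounded for the Mazurkiewicz distance; for a metric space this is
equivalent to compactness of the metric completion of `(Ω, mazDist)`. -/
def MazCompletionCompact (Ω : Set ℂ) : Prop :=
  ∀ ε > (0:ℝ), ∃ F : Finset ℂ, ↑F ⊆ Ω ∧ ∀ x ∈ Ω, ∃ y ∈ F, mazDist Ω x y < ε

/-- `f : A → B` is non-alternating: there are no `x, y ∈ B` and no separation of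
`A \ f⁻¹({x})` into two disjoint nonempty relatively open sets `A₁, A₂` with
`y ∈ f(A₁) ∩ f(A₂)`. -/
def NonAlternatingOn (f : ℂ → ℂ) (A B : Set ℂ) : Prop :=
  ¬ ∃ x ∈ B, ∃ y ∈ B, ∃ A₁ A₂ : Set ℂ,
      A₁.Nonempty ∧ A₂.Nonempty ∧ Disjoint A₁ A₂ ∧
      A₁ ∪ A₂ = {z | z ∈ A ∧ f z ≠ x} ∧
      (∃ U₁ : Set ℂ, IsOpen U₁ ∧ A₁ = U₁ ∩ {z | z ∈ A ∧ f z ≠ x}) ∧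
      (∃ U₂ : Set ℂ, IsOpen U₂ ∧ A₂ = U₂ ∩ {z | z ∈ A ∧ f z ≠ x}) ∧
      y ∈ f '' A₁ ∧ y ∈ f '' A₂

/-- `f` has a continuous logarithm on `K`. -/
def HasLogOn (f : ℂ → ℂ) (K : Set ℂ) : Prop :=
  ∃ g : ℂ → ℂ, ContinuousOn g K ∧ ∀ z ∈ K, Complex.exp (g z) = f z

theorem HasLogOn.mono {f : ℂ → ℂ} {K L : Set ℂ} (h : HasLogOn f L) (hKL : K ⊆ L) :
    HasLogOn f K :=
  let ⟨g, hg, hgf⟩ := h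
  ⟨g, hg.mono hKL, fun z hz => hgf z (hKL hz)⟩

theorem HasLogOn.congr {f₁ f₂ : ℂ → ℂ} {K : Set ℂ} (h : HasLogOn f₁ K) (hf : EqOn f₁ f₂ K) :
    HasLogOn f₂ K :=
  let ⟨g, hg, hgf⟩ := h
  ⟨g, hg, fun z hz => (hgf z hz).trans (hf hz)⟩

theorem HasLogOn.mul {f₁ f₂ : ℂ → ℂ} {K : Set ℂ} (h₁ : HasLogOn f₁ K) (h₂ : HasLogOn f₂ K) :
    HasLogOn (fun z => f₁ z * f₂ z) K :=
  let ⟨g₁, hg₁, h₁⟩ := h₁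
  let ⟨g₂, hg₂, h₂⟩ := h₂
  ⟨fun z => g₁ z + g₂ z, hg₁.add hg₂, fun z hz => by rw [Complex.exp_add, h₁ z hz, h₂ z hz]⟩

theorem HasLogOn.inv {f : ℂ → ℂ} {K : Set ℂ} (h : HasLogOn f K) :
    HasLogOn (fun z => (f z)⁻¹) K :=
  let ⟨g, hg, h⟩ := h
  ⟨fun z => -g z, hg.neg, fun z hz => by rw [Complex.exp_neg, h z hz]⟩

theorem hasLogOn_const {c : ℂ} (hc : c ≠ 0) (K : Set ℂ) : HasLogOn (fun _ => c) K :=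
  ⟨fun _ => Complex.log c, continuousOn_const, fun _ _ => Complex.exp_log hc⟩

theorem hasLogOn_of_mem_slitPlane {f : ℂ → ℂ} {K : Set ℂ} (hf : ContinuousOn f K)
    (h : ∀ z ∈ K, f z ∈ Complex.slitPlane) : HasLogOn f K :=
  ⟨fun z => Complex.log (f z), hf.clog h, fun z hz =>
    Complex.exp_log (Complex.slitPlane_ne_zero (h z hz))⟩

/-- Two continuous functions with the same exponential differ by a constant on a connected set. -/
theorem sub_eq_sub_of_exp_eq {g₁ g₂ : ℂ → ℂ} {C : Set ℂ} (hC : IsPreconnected C)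
    (h₁ : ContinuousOn g₁ C) (h₂ : ContinuousOn g₂ C)
    (h : ∀ z ∈ C, Complex.exp (g₁ z) = Complex.exp (g₂ z)) {z w : ℂ} (hz : z ∈ C) (hw : w ∈ C) :
    g₁ z - g₂ z = g₁ w - g₂ w := by
  have hpi : (2 * Real.pi * Complex.I : ℂ) ≠ 0 := Complex.two_pi_I_ne_zero
  let T : Set ℝ := range ((↑) : ℤ → ℝ)
  have hT : IsDiscrete T := by
    refine ⟨?_⟩
    exact (Int.isClosedEmbedding_coe_real.isEmbedding.toHomeomorph).symm.isEmbedding.discreteTopology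
  have hmem : ∀ z ∈ C, ∃ n : ℤ, g₁ z - g₂ z = n * (2 * Real.pi * Complex.I) := fun z hz => by
    obtain ⟨n, hn⟩ := Complex.exp_eq_exp_iff_exists_int.1 (h z hz)
    exact ⟨n, by rw [hn]; ring⟩
  let φ : ℂ → ℝ := fun z => ((g₁ z - g₂ z) / (2 * Real.pi * Complex.I)).re
  have hφ : ContinuousOn φ C :=
    Complex.continuous_re.comp_continuousOn ((h₁.sub h₂).div_const _)
  have hφv : ∀ z ∈ C, g₁ z - g₂ z = φ z * (2 * Real.pi * Complex.I) := fun z hz => by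
    obtain ⟨n, hn⟩ := hmem z hz
    simp only [φ, hn, mul_div_assoc, div_self hpi, mul_one, Complex.intCast_re,
      Complex.ofReal_intCast]
  have hmaps : MapsTo φ C T := fun z hz => by
    obtain ⟨n, hn⟩ := hmem z hz
    exact ⟨n, by simp only [φ, hn, mul_div_assoc, div_self hpi, mul_one, Complex.intCast_re]⟩
  obtain ⟨y, -, hy⟩ := hC.eqOn_const_of_mapsTo hT hφ hmaps ⟨0, 0, by simp⟩
  rw [hφv z hz, hφv w hw, hy hz, hy hw]
  rfl

theorem HasLogOn.union {f : ℂ → ℂ} {K L : Set ℂ} (hKc : IsClosed K) (hLc : IsClosed L)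
    (hK : HasLogOn f K) (hL : HasLogOn f L) (h : IsPreconnected (K ∩ L)) :
    HasLogOn f (K ∪ L) := by
  classical
  obtain ⟨g₁, hg₁, h₁⟩ := hK
  obtain ⟨g₂, hg₂, h₂⟩ := hL
  obtain ⟨c, hc, hce⟩ : ∃ c : ℂ, (∀ z ∈ K ∩ L, g₁ z = g₂ z + c) ∧ Complex.exp c = 1 := by
    rcases (K ∩ L).eq_empty_or_nonempty with he | ⟨p, hp⟩
    · exact ⟨0, by simp [he], by simp⟩
    · refine ⟨g₁ p - g₂ p, fun z hz => ?_, ?_⟩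
      · have := sub_eq_sub_of_exp_eq h (hg₁.mono inter_subset_left) (hg₂.mono inter_subset_right)
          (fun z hz => by rw [h₁ z hz.1, h₂ z hz.2]) hz hp
        rw [← this]; ring
      · rw [Complex.exp_sub, h₁ p hp.1, h₂ p hp.2, div_self]
        rw [← h₁ p hp.1]; exact Complex.exp_ne_zero _
  refine ⟨fun z => if z ∈ K then g₁ z else g₂ z + c, ContinuousOn.union_of_isClosed ?_ ?_ hKc hLc, ?_⟩
  · exact hg₁.congr fun z hz => by simp [hz]
  · refine (hg₂.add (continuousOn_const (c := c))).congr fun z hz => ?_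
    by_cases hzK : z ∈ K
    · simpa [hzK] using hc z ⟨hzK, hz⟩
    · simp [hzK]
  · intro z hz
    by_cases hzK : z ∈ K
    · simpa [hzK] using h₁ z hzK
    · simp only [hzK, if_false, Complex.exp_add, hce, mul_one]
      exact h₂ z (hz.resolve_left hzK)

theorem one_add_mem_slitPlane {w : ℂ} (hw : ‖w‖ < 1) : 1 + w ∈ Complex.slitPlane :=
  Complex.mem_slitPlane_of_norm_lt_one hw

/-- If `a` and `b` are much closer to each other than to `z`, then `(z - a) / (z - b)` lies in
the slit plane. -/
theorem div_sub_mem_slitPlane {z a b : ℂ} (h : ‖a - b‖ < ‖z - b‖) :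
    (z - a) / (z - b) ∈ Complex.slitPlane := by
  have hz : 0 < ‖z - b‖ := (norm_nonneg _).trans_lt h
  have hz' : z - b ≠ 0 := norm_pos_iff.1 hz
  have : (z - a) / (z - b) = 1 + (b - a) / (z - b) := by field_simp; ring
  rw [this]
  apply one_add_mem_slitPlane
  rw [norm_div, norm_sub_rev, div_lt_one hz]
  exact h

theorem continuousOn_div_sub {a b : ℂ} {K : Set ℂ} (hb : b ∉ K) :
    ContinuousOn (fun z : ℂ => (z - a) / (z - b)) K := by
  refine ContinuousOn.div (by fun_prop) (by fun_prop) fun z hz h => hb ?_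
  rwa [sub_eq_zero.1 h] at hz

/-- Points in a connected set disjoint from `K` are not separated by `K`, logarithmically. -/
theorem hasLogOn_of_isPreconnected {K C : Set ℂ} (hK : IsClosed K) (hC : IsPreconnected C)
    (hd : Disjoint C K) {a b : ℂ} (ha : a ∈ C) (hb : b ∈ C) :
    HasLogOn (fun z => (z - a) / (z - b)) K := by
  have hne : ∀ x ∈ C, ∀ z ∈ K, z - x ≠ 0 := fun x hx z hz h =>
    disjoint_left.1 hd hx (by rwa [← sub_eq_zero.1 h])
  refine hC.induction₂ (fun a b => HasLogOn (fun z => (z - a) / (z - b)) K) ?_ ?_ ?_ ha hb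
  · intro x hx
    obtain ⟨ε, hε, hball⟩ := Metric.isOpen_iff.1 hK.isOpen_compl x (disjoint_left.1 hd hx)
    filter_upwards [mem_nhdsWithin_of_mem_nhds (Metric.ball_mem_nhds x (half_pos hε)),
      self_mem_nhdsWithin] with y hy hyC
    refine hasLogOn_of_mem_slitPlane (continuousOn_div_sub (disjoint_left.1 hd hyC)) fun z hz => ?_
    apply div_sub_mem_slitPlane
    have h1 : ε ≤ dist z x := by
      by_contra! h
      exact hball h hz
    rw [← dist_eq_norm, ← dist_eq_norm]
    have h2 : dist y x < ε / 2 := hy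
    have h3 := dist_triangle z y x
    rw [dist_comm x y]
    linarith
  · intro x y z hx hy hz h₁ h₂
    refine (h₁.mul h₂).congr fun w hw => ?_
    have := hne y hy w hw
    have := hne z hz w hw
    simp only
    field_simp
  · intro x y hx hy h
    exact h.inv.congr fun w hw => by simp

theorem isPreconnected_compl_closedBall {R : ℝ} (hR : 0 < R) :
    IsPreconnected (closedBall (0 : ℂ) R)ᶜ := by
  have : (closedBall (0 : ℂ) R)ᶜ = Complex.exp '' {z | Real.log R < z.re} := by
    ext z
    simp only [mem_compl_iff, mem_closedBall, dist_zero_right, not_le, mem_image, mem_ofPred_eq]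
    constructor
    · intro h
      have hz : z ≠ 0 := norm_pos_iff.1 (hR.trans h)
      exact ⟨Complex.log z, by simpa [Complex.log_re] using Real.log_lt_log hR h,
        Complex.exp_log hz⟩
    · rintro ⟨w, hw, rfl⟩
      rw [Complex.norm_exp]
      exact (Real.log_lt_iff_lt_exp hR).1 hw
  rw [this]
  exact (convex_halfSpace_re_gt _).isPreconnected.image _ Complex.continuous_exp.continuousOn

theorem not_hasLogOn_sphere (a : ℂ) {R : ℝ} (hR : 0 < R) :
    ¬ HasLogOn (fun z => z - a) (sphere a R) := by
  rintro ⟨g, hg, h⟩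
  let e : ℂ → ℂ := fun t => a + R * Complex.exp (t.re * Complex.I)
  have he : ∀ t : ℂ, e t ∈ sphere a R := fun t => by
    simp [e, Complex.norm_exp, abs_of_pos hR]
  have hec : Continuous e := by fun_prop
  have h₁ : ContinuousOn (fun t => g (e t)) univ := hg.comp hec.continuousOn fun t _ => he t
  have h₂ : ContinuousOn (fun t : ℂ => Complex.log R + t.re * Complex.I) univ := by fun_prop
  have key := sub_eq_sub_of_exp_eq isPreconnected_univ h₁ h₂ (fun t _ => by
    rw [h _ (he t), Complex.exp_add, Complex.exp_log (by exact_mod_cast hR.ne')]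
    simp [e]) (mem_univ (0 : ℂ)) (mem_univ ((2 * Real.pi : ℝ) : ℂ))
  have he2 : e ((2 * Real.pi : ℝ) : ℂ) = e 0 := by
    simp [e, Complex.exp_two_pi_mul_I]
  rw [he2] at key
  simp at key

/-- A continuous function which agrees with `z - a` on a circle around `a` has a zero. -/
theorem exists_zero_of_eqOn_sphere {h : ℂ → ℂ} (hc : Continuous h) {a : ℂ} {R : ℝ} (hR : 0 < R)
    (hs : ∀ z ∈ sphere a R, h z = z - a) : ∃ z, h z = 0 := by
  by_contra! hne
  let F : ℝ → ℂ → ℂ := fun s z => h (a + s * (z - a))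
  have hF : Continuous fun p : ℝ × ℂ => F p.1 p.2 := by fun_prop
  have key : HasLogOn (fun z => F 1 z / F 0 z) (sphere a R) := by
    refine (isPreconnected_univ (α := ℝ)).induction₂
      (fun s t => HasLogOn (fun z => F s z / F t z) (sphere a R)) ?_ ?_ ?_ (mem_univ _) (mem_univ _)
    · intro s _
      rw [nhdsWithin_univ]
      have hev : ∀ᶠ t in 𝓝 s, ∀ z ∈ sphere a R, F s z / F t z ∈ Complex.slitPlane := by
        refine (isCompact_sphere a R).eventually_forall_of_forall_eventually fun z _ => ?_
        have : ContinuousAt (fun p : ℝ × ℂ => F s p.2 / F p.1 p.2) (s, z) := by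
          apply Continuous.continuousAt
          exact Continuous.div (by fun_prop) hF fun p => hne _
        refine this.eventually_mem (Complex.isOpen_slitPlane.mem_nhds ?_)
        simp only
        rw [div_self (hne _)]
        exact Complex.one_mem_slitPlane
      filter_upwards [hev] with t ht
      refine hasLogOn_of_mem_slitPlane (Continuous.continuousOn ?_) ht
      exact Continuous.div (by fun_prop) (by fun_prop) fun p => hne _
    · intro x y z _ _ _ h₁ h₂
      refine (h₁.mul h₂).congr fun w _ => ?_
      have h3 : F y w ≠ 0 := hne _
      have h4 : F z w ≠ 0 := hne _
      simp only
      field_simp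
    · intro x y _ _ h
      exact h.inv.congr fun w _ => by simp
  have h0 : h a ≠ 0 := hne a
  refine not_hasLogOn_sphere a hR ((key.mul (hasLogOn_const h0 _)).congr fun z hz => ?_)
  simp [F, h0, hs z hz]

theorem frontier_connectedComponentIn_compl_subset {K : Set ℂ} (hK : IsClosed K) (a : ℂ) :
    frontier (connectedComponentIn Kᶜ a) ⊆ K := by
  intro z hz
  by_contra hzK
  have ho := hK.isOpen_compl.connectedComponentIn (x := a)
  have ho' := hK.isOpen_compl.connectedComponentIn (x := z)
  obtain ⟨y, hy, hy'⟩ := mem_closure_iff.1 hz.1 _ ho' (mem_connectedComponentIn hzK)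
  rw [frontier, ho.interior_eq] at hz
  apply hz.2
  rw [connectedComponentIn_eq hy', ← connectedComponentIn_eq hy]
  exact mem_connectedComponentIn hzK

theorem mem_connectedComponentIn_of_hasLogOn_of_isBounded {K : Set ℂ} (hK : IsCompact K) {a b : ℂ}
    (ha : a ∉ K) (hb : b ∉ K) (h : HasLogOn (fun z => (z - a) / (z - b)) K)
    (hbd : Bornology.IsBounded (connectedComponentIn Kᶜ a)) :
    b ∈ connectedComponentIn Kᶜ a := by
  classical
  by_contra hbU
  set U := connectedComponentIn Kᶜ a with hU
  have haU : a ∈ U := mem_connectedComponentIn ha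
  obtain ⟨g, hg, hgf⟩ := h
  obtain ⟨G, hG⟩ := ContinuousMap.exists_restrict_eq hK.isClosed
    (⟨K.domRestrict g, hg.domRestrict⟩ : C(K, ℂ))
  have hGg : ∀ z ∈ K, G z = g z := fun z hz => congrArg (fun f : C(K, ℂ) => f ⟨z, hz⟩) hG
  obtain ⟨R, hR⟩ := hbd.subset_ball a
  have hR0 : 0 < R := dist_nonneg.trans_lt (hR haU)
  have hc : Continuous (U.piecewise (fun z => (z - b) * Complex.exp (G z)) (fun z => z - a)) := by
    refine Continuous.piecewise (fun z hz => ?_) (by fun_prop) (by fun_prop)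
    have hzK := frontier_connectedComponentIn_compl_subset hK.isClosed a hz
    have hzb : z - b ≠ 0 := fun h => hb (by rwa [sub_eq_zero.1 h] at hzK)
    rw [hGg z hzK, hgf z hzK]
    field_simp
  obtain ⟨z, hz⟩ := exists_zero_of_eqOn_sphere hc hR0 (fun z hz => by
    have : z ∉ U := fun h => by
      have := hR h
      rw [mem_ball, mem_sphere.1 hz] at this
      exact lt_irrefl _ this
    simp [this])
  by_cases hzU : z ∈ U
  · rw [piecewise_eq_of_mem _ _ _ hzU] at hz
    rcases mul_eq_zero.1 hz with h | h
    · rw [sub_eq_zero.1 h] at hzU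
      exact hbU hzU
    · exact Complex.exp_ne_zero _ h
  · rw [piecewise_eq_of_notMem _ _ _ hzU] at hz
    rw [sub_eq_zero.1 hz] at hzU
    exact hzU haU

/-- Eilenberg's criterion: if `(z - a) / (z - b)` has a continuous logarithm on the compact set
`K`, then `K` does not separate `a` from `b`. -/
theorem mem_connectedComponentIn_of_hasLogOn {K : Set ℂ} (hK : IsCompact K) {a b : ℂ}
    (ha : a ∉ K) (hb : b ∉ K) (h : HasLogOn (fun z => (z - a) / (z - b)) K) :
    b ∈ connectedComponentIn Kᶜ a := by
  have hsymm : a ∈ connectedComponentIn Kᶜ b → b ∈ connectedComponentIn Kᶜ a := fun h => by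
    rw [← connectedComponentIn_eq h]
    exact mem_connectedComponentIn hb
  by_cases hA : Bornology.IsBounded (connectedComponentIn Kᶜ a)
  · exact mem_connectedComponentIn_of_hasLogOn_of_isBounded hK ha hb h hA
  by_cases hB : Bornology.IsBounded (connectedComponentIn Kᶜ b)
  · exact hsymm (mem_connectedComponentIn_of_hasLogOn_of_isBounded hK hb ha
      (h.inv.congr fun z _ => by simp) hB)
  obtain ⟨R, hR0, hR⟩ := hK.isBounded.subset_closedBall_lt 0 0
  have key : ∀ c, ¬ Bornology.IsBounded (connectedComponentIn Kᶜ c) →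
      (closedBall (0 : ℂ) R)ᶜ ⊆ connectedComponentIn Kᶜ c := by
    intro c hc
    obtain ⟨z, hz, hzR⟩ : ∃ z ∈ connectedComponentIn Kᶜ c, z ∈ (closedBall (0 : ℂ) R)ᶜ := by
      by_contra! hcon
      exact hc ((isBounded_closedBall (x := (0 : ℂ)) (r := R)).subset fun z hz => by
        simpa using hcon z hz)
    rw [connectedComponentIn_eq hz]
    exact (isPreconnected_compl_closedBall hR0).subset_connectedComponentIn hzR
      (compl_subset_compl.2 hR)
  have hzR : ((R + 1 : ℝ) : ℂ) ∈ (closedBall (0 : ℂ) R)ᶜ := by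
    simp only [mem_compl_iff, mem_closedBall, dist_zero_right, Complex.norm_real, Real.norm_eq_abs,
      not_le]
    exact (lt_add_one R).trans_le (le_abs_self _)
  have h1 := key a hA hzR
  have h2 := key b hB hzR
  rw [connectedComponentIn_eq h1, ← connectedComponentIn_eq h2]
  exact mem_connectedComponentIn hb

theorem exists_isClosed_disjoint_of_connectedComponentIn {K D : Set ℂ} (hK : IsCompact K) {z : ℂ}
    (hz : z ∈ K) (hD : IsClosed D) (h : Disjoint D (connectedComponentIn K z)) :
    ∃ W ⊆ K, IsClosed W ∧ IsClosed (K \ W) ∧ z ∈ W ∧ Disjoint W D := by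
  have := isCompact_iff_compactSpace.mp hK
  set z' : K := ⟨z, hz⟩
  have h1 : ((↑) ⁻¹' D : Set K) ∩ connectedComponent z' = ∅ := by
    rw [connectedComponentIn_eq_image hz] at h
    ext w
    simp only [mem_inter_iff, mem_preimage, mem_empty_iff_false, iff_false, not_and]
    exact fun hw hw' => h.le_bot ⟨hw, w, hw', rfl⟩
  rw [connectedComponent_eq_iInter_isClopen] at h1
  obtain ⟨t, ht⟩ := (hD.preimage continuous_subtype_val).isCompact.elim_finite_subfamily_closed
    _ (fun s : { s : Set K // IsClopen s ∧ z' ∈ s } => s.2.1.1) h1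
  set U : Set K := ⋂ (i : { s // IsClopen s ∧ z' ∈ s }) (_ : i ∈ t), i
  have hU : IsClopen U := isClopen_biInter_finset fun i _ => i.2.1
  have hemb := hK.isClosed.isClosedEmbedding_subtypeVal
  refine ⟨(↑) '' U, by rintro _ ⟨w, -, rfl⟩; exact w.2, hemb.isClosedMap _ hU.1, ?_,
    ⟨z', mem_iInter₂.2 fun i _ => i.2.2, rfl⟩, ?_⟩
  · have : K \ ((↑) '' U) = (↑) '' (Uᶜ : Set K) := by
      ext w
      constructor
      · rintro ⟨hw, hw'⟩
        exact ⟨⟨w, hw⟩, fun h => hw' ⟨_, h, rfl⟩, rfl⟩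
      · rintro ⟨w, hw, rfl⟩
        refine ⟨w.2, ?_⟩
        rintro ⟨v, hv, hvw⟩
        exact hw (Subtype.ext hvw ▸ hv)
    rw [this]
    exact hemb.isClosedMap _ hU.compl.1
  · rw [disjoint_left]
    rintro _ ⟨w, hw, rfl⟩ hwD
    exact (ht ▸ ⟨hwD, hw⟩ : w ∈ (∅ : Set K))

theorem exists_continuousOn_union {A B : Set ℂ} (hA : IsClosed A) (hB : IsClosed B) {g₁ g₂ : ℂ → ℂ}
    (h₁ : ContinuousOn g₁ A) (h₂ : ContinuousOn g₂ B) (h : EqOn g₁ g₂ (A ∩ B)) :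
    ∃ g, ContinuousOn g (A ∪ B) ∧ EqOn g g₁ A ∧ EqOn g g₂ B := by
  classical
  have e1 : EqOn (A.piecewise g₁ g₂) g₁ A := piecewise_eqOn _ _ _
  have e2 : EqOn (A.piecewise g₁ g₂) g₂ B := fun z hz => by
    by_cases hzA : z ∈ A
    · rw [e1 hzA, h ⟨hzA, hz⟩]
    · exact piecewise_eq_of_notMem _ _ _ hzA
  exact ⟨_, (h₁.congr e1).union_of_isClosed (h₂.congr e2) hA hB, e1, e2⟩

theorem eq_zero_of_exp_eq_one_of_norm_lt {u : ℂ} (h : Complex.exp u = 1) (hu : ‖u‖ < 1) :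
    u = 0 := by
  obtain ⟨n, rfl⟩ := Complex.exp_eq_one_iff.1 h
  have : |(n : ℝ)| * (2 * Real.pi) < 1 := by
    simpa [abs_of_pos Real.pi_pos] using hu
  have h2 : |(n : ℝ)| < 1 := by nlinarith [Real.pi_gt_three, abs_nonneg (n : ℝ)]
  have h3 : |n| < 1 := by exact_mod_cast h2
  simp [Int.abs_lt_one_iff.1 h3]

theorem hasLogOn_union_of_const_on_components {K S : Set ℂ} (hK : IsCompact K) (hS : IsClosed S)
    {f l P : ℂ → ℂ} (hl : ContinuousOn l K) (hlf : ∀ z ∈ K, Complex.exp (l z) = f z)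
    (hP : ContinuousOn P S) (hPf : ∀ z ∈ S, Complex.exp (P z) = f z)
    (hc : ∀ z ∈ K, ∃ c, ∀ w ∈ connectedComponentIn K z ∩ S, l w - P w = c) :
    HasLogOn f (K ∪ S) := by
  let T : Set ℂ → Prop := fun W => W ⊆ K ∧ IsClosed W ∧ IsClosed (K \ W) ∧
    ∃ g, ContinuousOn g (S ∪ W) ∧ (∀ z ∈ W, Complex.exp (g z) = f z) ∧ EqOn g P S
  have hMc : ContinuousOn (fun w => l w - P w) (K ∩ S) :=
    (hl.mono inter_subset_left).sub (hP.mono inter_subset_right)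
  have key : ∃ W, K ⊆ W ∧ T W := by
    refine hK.induction_on (p := fun s => ∃ W, s ⊆ W ∧ T W) ?_ ?_ ?_ ?_
    · exact ⟨∅, subset_rfl, empty_subset _, isClosed_empty, by simpa using hK.isClosed, P,
        by simpa using hP, by simp, fun _ _ => rfl⟩
    · rintro s t hst ⟨W, h1, h2⟩
      exact ⟨W, hst.trans h1, h2⟩
    · rintro s t ⟨W₁, hs, h1K, h1c, h1d, g₁, h1g, h1f, h1P⟩
        ⟨W₂, ht, h2K, h2c, h2d, g₂, h2g, h2f, h2P⟩
      have hW : W₂ \ W₁ = W₂ ∩ (K \ W₁) := by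
        ext w
        simp only [Set.mem_sdiff, mem_inter_iff]
        exact ⟨fun h => ⟨h.1, h2K h.1, h.2⟩, fun h => ⟨h.1, h.2.2⟩⟩
      have hWc : IsClosed (W₂ \ W₁) := hW ▸ h2c.inter h1d
      obtain ⟨g, hg, hg1, hg2⟩ := exists_continuousOn_union (hS.union h1c) (hS.union hWc) h1g
        (h2g.mono (union_subset_union_right _ sdiff_subset)) (by
          rintro w ⟨hw1, hw2⟩
          have : w ∈ S := by
            rcases hw2 with h | h
            · exact h
            · exact hw1.resolve_right h.2
          rw [h1P this, h2P this])
      refine ⟨W₁ ∪ W₂, union_subset_union hs ht, union_subset h1K h2K, h1c.union h2c, ?_, g, ?_, ?_,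
        fun w hw => (hg1 (Or.inl hw)).trans (h1P hw)⟩
      · rw [← sdiff_inter_sdiff]
        exact h1d.inter h2d
      · refine hg.mono ?_
        rintro w (hw | hw | hw)
        · exact Or.inl (Or.inl hw)
        · exact Or.inl (Or.inr hw)
        · by_cases h : w ∈ W₁
          · exact Or.inl (Or.inr h)
          · exact Or.inr (Or.inr ⟨hw, h⟩)
      · intro w hw
        by_cases h : w ∈ W₁
        · rw [hg1 (Or.inr h), h1f w h]
        · have hw' := hw.resolve_left h
          rw [hg2 (Or.inr ⟨hw', h⟩), h2f w hw']
    · intro z hz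
      obtain ⟨c, hcc, hc1⟩ : ∃ c, (∀ w ∈ connectedComponentIn K z ∩ S, l w - P w = c) ∧
          Complex.exp c = 1 := by
        by_cases hne : (connectedComponentIn K z ∩ S).Nonempty
        · obtain ⟨w, hw⟩ := hne
          obtain ⟨c, hc⟩ := hc z hz
          refine ⟨c, hc, ?_⟩
          have hwK := connectedComponentIn_subset _ _ hw.1
          rw [← hc w hw, Complex.exp_sub, hlf w hwK, hPf w hw.2, div_self]
          rw [← hlf w hwK]
          exact Complex.exp_ne_zero _
        · exact ⟨0, fun w hw => (hne ⟨w, hw⟩).elim, Complex.exp_zero⟩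
      have hD : IsClosed ((K ∩ S) ∩ (fun w => l w - P w) ⁻¹' (ball c 1)ᶜ) :=
        hMc.preimage_isClosed_of_isClosed (hK.isClosed.inter hS) isOpen_ball.isClosed_compl
      obtain ⟨W, hWK, hWc, hWd, hzW, hWD⟩ := exists_isClosed_disjoint_of_connectedComponentIn hK hz
        hD (by
          rw [disjoint_left]
          rintro w ⟨⟨-, hwS⟩, hw⟩ hwC
          exact hw (by
            have := hcc w ⟨hwC, hwS⟩
            simp [this]))
      have hWl : ∀ w ∈ S ∩ W, l w - P w = c := by
        rintro w ⟨hwS, hwW⟩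
        have h1 : l w - P w ∈ ball c 1 := by
          by_contra h
          exact hWD.le_bot ⟨hwW, ⟨hWK hwW, hwS⟩, h⟩
        rw [mem_ball, dist_eq_norm] at h1
        refine sub_eq_zero.1 (eq_zero_of_exp_eq_one_of_norm_lt ?_ h1)
        rw [Complex.exp_sub, Complex.exp_sub, hc1, hlf w (hWK hwW), hPf w hwS, div_one, div_self]
        rw [← hPf w hwS]
        exact Complex.exp_ne_zero _
      obtain ⟨g, hg, hg1, hg2⟩ := exists_continuousOn_union hS hWc hP
        ((hl.mono hWK).sub (continuousOn_const (c := c))) (fun w hw => by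
          simp [← hWl w hw])
      refine ⟨W, ?_, W, subset_rfl, hWK, hWc, hWd, g, hg, ?_, hg1⟩
      · have : (K \ W)ᶜ ∈ 𝓝 z := hWd.isOpen_compl.mem_nhds (fun h => h.2 hzW)
        filter_upwards [mem_nhdsWithin_of_mem_nhds this, self_mem_nhdsWithin] with w hw hwK
        by_contra h
        exact hw ⟨hwK, h⟩
      · intro w hw
        rw [hg2 hw]
        rw [Pi.sub_apply, Complex.exp_sub, hc1, div_one, hlf w (hWK hw)]
  obtain ⟨W, hKW, -, -, -, g, hg, hgf, hgP⟩ := key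
  refine ⟨g, hg.mono (by rw [union_comm]; exact union_subset_union_right _ hKW), ?_⟩
  rintro z (hz | hz)
  · exact hgf z (hKW hz)
  · rw [hgP hz, hPf z hz]

theorem IsPreconnected.subset_of_disjoint_frontier {X : Type*} [TopologicalSpace X] {C U : Set X}
    (hC : IsPreconnected C) (hd : Disjoint C (frontier U)) (hne : (C ∩ U).Nonempty) : C ⊆ U := by
  refine (hC.subset_left_of_subset_union isOpen_interior isClosed_closure.isOpen_compl
    (disjoint_compl_right.mono_left (interior_subset.trans subset_closure)) ?_ ?_).trans
    interior_subset
  · intro z hz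
    by_cases h : z ∈ closure U
    · exact Or.inl (by_contra fun h' => hd.le_bot ⟨hz, h, h'⟩)
    · exact Or.inr h
  · obtain ⟨z, hz, hzU⟩ := hne
    exact ⟨z, hz, by_contra fun h' => hd.le_bot ⟨hz, subset_closure hzU, h'⟩⟩

theorem exists_isPreconnected_of_isJordanCurve {Q : Set ℂ} (e : ↥Q ≃ₜ ↥(sphere (0 : ℂ) 1)) {x : ℂ}
    (hx : x ∈ Q) {s : ℝ} (hs : 0 < s) :
    ∃ J ⊆ Q, IsClosed J ∧ IsPreconnected J ∧ Q \ ball x s ⊆ J ∧ x ∉ J := by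
  set u : ℂ := (e ⟨x, hx⟩ : ℂ) with hu
  have hu1 : ‖u‖ = 1 := mem_sphere_zero_iff_norm.1 (e ⟨x, hx⟩).2
  have hu0 : u ≠ 0 := by
    rintro h
    simp [h] at hu1
  have hmem : ∀ t : ℝ, u * Complex.exp (t * Complex.I) ∈ sphere (0 : ℂ) 1 := fun t => by
    simp [hu1, Complex.norm_exp_ofReal_mul_I]
  set c : ℝ → ℂ := fun t => (e.symm ⟨u * Complex.exp (t * Complex.I), hmem t⟩ : ℂ) with hcdef
  have hc : Continuous c := by
    refine continuous_subtype_val.comp (e.symm.continuous.comp (Continuous.subtype_mk ?_ _))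
    fun_prop
  have hcQ : ∀ t, c t ∈ Q := fun t => Subtype.coe_prop _
  have hcx : ∀ t, c t = x ↔ Complex.exp (t * Complex.I) = 1 := fun t => by
    have : c t = x ↔ e.symm ⟨u * Complex.exp (t * Complex.I), hmem t⟩ = ⟨x, hx⟩ :=
      ⟨fun h => Subtype.ext h, fun h => congrArg Subtype.val h⟩
    rw [this, e.symm_apply_eq, Subtype.ext_iff]
    simp only
    rw [← hu]
    exact mul_eq_left₀ hu0
  have hsurj : ∀ z ∈ Q, ∃ t : ℝ, t ∈ Icc (-Real.pi) Real.pi ∧ c t = z := fun z hz => by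
    set v : ℂ := (e ⟨z, hz⟩ : ℂ) with hv
    have hv1 : ‖v‖ = 1 := mem_sphere_zero_iff_norm.1 (e ⟨z, hz⟩).2
    refine ⟨(v / u).arg, ⟨(Complex.neg_pi_lt_arg _).le, Complex.arg_le_pi _⟩, ?_⟩
    have h1 : u * Complex.exp ((v / u).arg * Complex.I) = v := by
      have := Complex.norm_mul_exp_arg_mul_I (v / u)
      rw [norm_div, hv1, hu1, div_one, Complex.ofReal_one, one_mul] at this
      rw [this, mul_div_cancel₀ _ hu0]
    have h2 : (⟨u * Complex.exp ((v / u).arg * Complex.I), hmem _⟩ : sphere (0 : ℂ) 1)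
        = e ⟨z, hz⟩ := Subtype.ext h1
    simp only [hcdef]
    rw [h2, e.symm_apply_apply]
  have h0 : c 0 = x := (hcx 0).2 (by simp)
  obtain ⟨ε, hε, hεs⟩ := Metric.continuous_iff.1 hc 0 s hs
  have hper : ∀ t, c (t + 2 * Real.pi) = c t := fun t => by
    simp only [hcdef]
    congr 4
    push_cast
    rw [add_mul, Complex.exp_add, Complex.exp_two_pi_mul_I, mul_one]
  set δ := min (ε / 2) 1
  have hδ : 0 < δ := lt_min (by positivity) one_pos
  have hδε : δ < ε := (min_le_left _ _).trans_lt (by linarith)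
  have hδ1 : δ ≤ 1 := min_le_right _ _
  have hpi := Real.pi_gt_three
  refine ⟨c '' Icc δ (2 * Real.pi - δ), image_subset_iff.2 fun t _ => hcQ t,
    (isCompact_Icc.image hc).isClosed, isPreconnected_Icc.image c hc.continuousOn, ?_, ?_⟩
  · rintro z ⟨hz, hzs⟩
    obtain ⟨t, ht, rfl⟩ := hsurj z hz
    have hte : ε ≤ |t| := by
      by_contra! h
      have := hεs t (by simpa using h)
      rw [h0] at this
      exact hzs this
    rcases le_total 0 t with h | h
    · rw [abs_of_nonneg h] at hte
      exact ⟨t, ⟨by linarith, by linarith [ht.2]⟩, rfl⟩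
    · rw [abs_of_nonpos h] at hte
      exact ⟨t + 2 * Real.pi, ⟨by linarith [ht.1], by linarith⟩, hper t⟩
  · rintro ⟨t, ht, htx⟩
    obtain ⟨n, hn⟩ := Complex.exp_eq_one_iff.1 ((hcx t).1 htx)
    have h1 : (t : ℂ) = ((n * (2 * Real.pi) : ℝ) : ℂ) := by
      have : (t : ℂ) * Complex.I = (n * (2 * Real.pi)) * Complex.I := by rw [hn]; ring
      push_cast
      exact mul_right_cancel₀ Complex.I_ne_zero this
    have h2 : t = n * (2 * Real.pi) := by exact_mod_cast h1
    have h3 : (0 : ℝ) < n := by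
      by_contra! h
      nlinarith [ht.1]
    have h4 : (n : ℝ) < 1 := by
      by_contra! h
      nlinarith [ht.2]
    have h3' : 0 < n := by exact_mod_cast h3
    have h4' : n < 1 := by exact_mod_cast h4
    omega

theorem isClosed_connectedComponentIn {K : Set ℂ} (hK : IsClosed K) (x : ℂ) :
    IsClosed (connectedComponentIn K x) := by
  by_cases hx : x ∈ K
  · refine isClosed_of_closure_subset ?_
    exact isPreconnected_connectedComponentIn.closure.subset_connectedComponentIn
      (subset_closure (mem_connectedComponentIn hx))
      (closure_minimal (connectedComponentIn_subset _ _) hK)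
  · rw [connectedComponentIn_eq_empty hx]
    exact isClosed_empty

theorem exists_ball_inter_subset_connectedComponentIn {Ω : Set ℂ} (hΩo : IsOpen Ω)
    (hΩc : IsPreconnected Ω) (hb : Bornology.IsBounded Ω) {x : ℂ} {s : ℝ} (hs : 0 < s)
    (hJ : ∃ J ⊆ connectedComponentIn (frontier Ω) x, IsClosed J ∧ IsPreconnected J ∧
      connectedComponentIn (frontier Ω) x \ ball x s ⊆ J ∧ x ∉ J)
    (hfin : {Q : Set ℂ | (∃ y ∈ frontier Ω, Q = connectedComponentIn (frontier Ω) y) ∧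
      s / 3 < diam Q}.Finite) :
    ∃ ρ > 0, ρ < s ∧ ∀ a ∈ Ω ∩ ball x ρ, ∀ b ∈ Ω ∩ ball x ρ,
      b ∈ connectedComponentIn (frontier Ω ∪ sphere x s)ᶜ a := by
  set K := frontier Ω with hKdef
  have hK : IsCompact K := hb.isCompact_closure.of_isClosed_subset isClosed_frontier
    frontier_subset_closure
  have hKΩ : Disjoint Ω K := by
    rw [hKdef, hΩo.frontier_eq]
    exact disjoint_sdiff_right
  obtain ⟨J, hJQ, hJc, hJp, hJs, hxJ⟩ := hJ
  set 𝓕 := {Q : Set ℂ | ((∃ y ∈ K, Q = connectedComponentIn K y) ∧ s / 3 < diam Q) ∧ x ∉ Q}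
  have h𝓕 : 𝓕.Finite := hfin.subset fun Q hQ => hQ.1
  have hcl : IsClosed (J ∪ ⋃₀ 𝓕) := by
    rw [sUnion_eq_biUnion]
    refine hJc.union (h𝓕.isClosed_biUnion ?_)
    rintro _ ⟨⟨⟨y, -, rfl⟩, -⟩, -⟩
    exact isClosed_connectedComponentIn hK.isClosed y
  have hxcl : x ∉ J ∪ ⋃₀ 𝓕 := by
    rintro (h | ⟨Q, hQ, hxQ⟩)
    · exact hxJ h
    · exact hQ.2 hxQ
  obtain ⟨ρ', hρ', hρJ⟩ := Metric.isOpen_iff.1 hcl.isOpen_compl x hxcl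
  obtain ⟨ρ, hρ, hρ1, hρ2⟩ : ∃ ρ, 0 < ρ ∧ ρ ≤ ρ' ∧ ρ ≤ s / 2 :=
    ⟨min ρ' (s / 2), by positivity, min_le_left _ _, min_le_right _ _⟩
  refine ⟨ρ / 4, by positivity, by linarith, ?_⟩
  rintro a ⟨haΩ, hax⟩ b ⟨hbΩ, hbx⟩
  rw [mem_ball] at hax hbx
  have hnot : ∀ z ∈ Ω, z ∈ ball x (ρ / 4) → z ∉ K ∪ sphere x s := by
    rintro z hz hzx (h | h)
    · exact hKΩ.le_bot ⟨hz, h⟩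
    · rw [mem_sphere] at h
      rw [mem_ball] at hzx
      linarith
  refine mem_connectedComponentIn_of_hasLogOn (hK.union (isCompact_sphere x s))
    (hnot a haΩ hax) (hnot b hbΩ hbx) ?_
  obtain ⟨l, hl, hlf⟩ := hasLogOn_of_isPreconnected hK.isClosed hΩc hKΩ haΩ hbΩ
  have hslit : ∀ z ∈ (ball x ρ)ᶜ, (z - a) / (z - b) ∈ Complex.slitPlane := by
    intro z hz
    refine div_sub_mem_slitPlane ?_
    rw [mem_compl_iff, mem_ball, not_lt] at hz
    rw [← dist_eq_norm, ← dist_eq_norm]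
    have h1 := dist_triangle z b x
    have h2 := dist_triangle_right a b x
    linarith
  have hbρ : b ∉ (ball x ρ)ᶜ := fun h => h (by rw [mem_ball]; linarith)
  set P : ℂ → ℂ := fun z => Complex.log ((z - a) / (z - b))
  have hP : ContinuousOn P (ball x ρ)ᶜ := (continuousOn_div_sub hbρ).clog hslit
  have hPf : ∀ z ∈ (ball x ρ)ᶜ, Complex.exp (P z) = (z - a) / (z - b) := fun z hz =>
    Complex.exp_log (Complex.slitPlane_ne_zero (hslit z hz))
  have hSρ : sphere x s ⊆ (ball x ρ)ᶜ := fun z hz h => by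
    rw [mem_sphere] at hz
    rw [mem_ball] at h
    linarith
  refine hasLogOn_union_of_const_on_components hK isClosed_sphere hl hlf (hP.mono hSρ)
    (fun z hz => hPf z (hSρ hz)) ?_
  have main : ∀ C, IsPreconnected C → C ⊆ K → C ⊆ (ball x ρ)ᶜ →
      ∃ c, ∀ w ∈ C, l w - P w = c := by
    intro C hC hCK hCρ
    rcases C.eq_empty_or_nonempty with rfl | ⟨w₀, hw₀⟩
    · exact ⟨0, by simp⟩
    · exact ⟨l w₀ - P w₀, fun w hw => sub_eq_sub_of_exp_eq hC (hl.mono hCK) (hP.mono hCρ)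
        (fun z hz => by rw [hlf z (hCK hz), hPf z (hCρ hz)]) hw hw₀⟩
  intro z hz
  by_cases hxz : x ∈ connectedComponentIn K z
  · have hQ := connectedComponentIn_eq hxz
    obtain ⟨c, hc⟩ := main J hJp (hJQ.trans (connectedComponentIn_subset _ _))
      (fun w hw h => hρJ (ball_subset_ball hρ1 h) (Or.inl hw))
    refine ⟨c, fun w hw => hc w (hJs ⟨hQ ▸ hw.1, fun h => ?_⟩)⟩
    have h2 := hw.2
    rw [mem_sphere] at h2
    rw [mem_ball] at h
    linarith
  · by_cases hne : (connectedComponentIn K z ∩ sphere x s).Nonempty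
    · obtain ⟨c, hc⟩ := main (connectedComponentIn K z) isPreconnected_connectedComponentIn
        (connectedComponentIn_subset _ _) (fun w hw h => by
          by_cases hd : s / 3 < diam (connectedComponentIn K z)
          · exact hρJ (ball_subset_ball hρ1 h) (Or.inr ⟨_, ⟨⟨⟨z, hz, rfl⟩, hd⟩, hxz⟩, hw⟩)
          · obtain ⟨v, hv, hvs⟩ := hne
            rw [mem_sphere] at hvs
            rw [mem_ball] at h
            have h1 := dist_le_diam_of_mem
              (hK.isBounded.subset (connectedComponentIn_subset K z)) hv hw
            have h2 := dist_triangle v w x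
            linarith)
      exact ⟨c, fun w hw => hc w hw.1⟩
    · exact ⟨0, fun w hw => (hne ⟨w, hw⟩).elim⟩

theorem exists_isConnected_inter_of_connectedComponentIn_frontier {Ω : Set ℂ} (hΩo : IsOpen Ω)
    (hΩc : IsPreconnected Ω) (hb : Bornology.IsBounded Ω) {x : ℂ} {r : ℝ} (hr : 0 < r)
    (hJ : connectedComponentIn (frontier Ω) x = {x} ∨
      Nonempty (↥(connectedComponentIn (frontier Ω) x) ≃ₜ ↥(Metric.sphere (0:ℂ) 1)))
    (hfin : ∀ C : ℝ, 0 < C → {Q : Set ℂ | (∃ y ∈ frontier Ω,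
      Q = connectedComponentIn (frontier Ω) y) ∧ C < diam Q}.Finite) (hx : x ∈ frontier Ω) :
    ∃ U : Set ℂ, IsOpen U ∧ x ∈ U ∧ U ⊆ Metric.ball x r ∧ IsConnected (U ∩ Ω) := by
  obtain ⟨ρ, hρ, hρs, hρV⟩ := exists_ball_inter_subset_connectedComponentIn hΩo hΩc hb
    (half_pos hr) (x := x) (by
      rcases hJ with h | ⟨⟨e⟩⟩
      · exact ⟨∅, empty_subset _, isClosed_empty, isPreconnected_empty, by
          rw [h, sdiff_subset_iff, union_empty, singleton_subset_iff]
          exact mem_ball_self (half_pos hr), by simp⟩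
      · exact exists_isPreconnected_of_isJordanCurve e (mem_connectedComponentIn hx) (half_pos hr))
    (hfin _ (by positivity))
  obtain ⟨a, haρ, haΩ⟩ := mem_closure_iff.1 (frontier_subset_closure hx) _ isOpen_ball
    (mem_ball_self hρ)
  set V := connectedComponentIn (frontier Ω ∪ sphere x (r / 2))ᶜ a with hV
  have hVsub := connectedComponentIn_subset (frontier Ω ∪ sphere x (r / 2))ᶜ a
  have haV : a ∈ V := hρV a ⟨haΩ, haρ⟩ a ⟨haΩ, haρ⟩
  have hVp : IsPreconnected V := isPreconnected_connectedComponentIn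
  have hVΩ : V ⊆ Ω := hVp.subset_of_disjoint_frontier
    (disjoint_left.2 fun z hz h => hVsub hz (Or.inl h)) ⟨a, haV, haΩ⟩
  have hVb : V ⊆ ball x (r / 2) := hVp.subset_of_disjoint_frontier
    (disjoint_left.2 fun z hz h => hVsub hz (Or.inr (by rwa [frontier_ball x (half_pos hr).ne'] at h)))
    ⟨a, haV, ball_subset_ball hρs.le haρ⟩
  have hVo : IsOpen V :=
    (isClosed_frontier.union isClosed_sphere).isOpen_compl.connectedComponentIn
  refine ⟨ball x ρ ∪ V, isOpen_ball.union hVo, Or.inl (mem_ball_self hρ),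
    union_subset (ball_subset_ball (by linarith)) (hVb.trans (ball_subset_ball (by linarith))), ?_⟩
  have : (ball x ρ ∪ V) ∩ Ω = V := by
    refine Subset.antisymm ?_ fun z hz => ⟨Or.inr hz, hVΩ hz⟩
    rintro z ⟨hz | hz, hzΩ⟩
    · exact hρV a ⟨haΩ, haρ⟩ z ⟨hzΩ, hz⟩
    · exact hz
  rw [this]
  exact ⟨⟨a, haV⟩, hVp⟩

/-- Every boundary point of `Ω` has arbitrarily small neighbourhoods with connected trace on
`Ω`. -/
def SimplyConnectedAtBoundary (Ω : Set ℂ) : Prop :=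
  ∀ x ∈ frontier Ω, ∀ r > (0 : ℝ), ∃ U : Set ℂ, IsOpen U ∧ x ∈ U ∧ U ⊆ ball x r ∧
    IsConnected (U ∩ Ω)

theorem SimplyConnectedAtBoundary.exists_continuum {Ω : Set ℂ} (H : SimplyConnectedAtBoundary Ω)
    (hΩo : IsOpen Ω) {x : ℂ} (hx : x ∈ frontier Ω) {r : ℝ} (hr : 0 < r) :
    ∃ A, IsCompact A ∧ IsConnected A ∧ x ∈ A ∧ A ⊆ insert x (Ω ∩ ball x r) ∧
      ∃ a ∈ A, a ∈ Ω := by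
  have loc : ∀ ε > (0 : ℝ), ∃ δ > (0 : ℝ), ∀ a ∈ Ω ∩ ball x δ, ∀ b ∈ Ω ∩ ball x δ,
      ∃ K, IsCompact K ∧ IsConnected K ∧ K ⊆ Ω ∩ ball x ε ∧ a ∈ K ∧ b ∈ K := by
    intro ε hε
    obtain ⟨U, hU, hxU, hUε, hUc⟩ := H x hx ε hε
    obtain ⟨δ, hδ, hδU⟩ := Metric.isOpen_iff.1 hU x hxU
    refine ⟨δ, hδ, fun a ha b hb => ?_⟩
    obtain ⟨γ, hγ⟩ := ((hU.inter hΩo).isConnected_iff_isPathConnected.1 hUc).joinedIn a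
      ⟨hδU ha.2, ha.1⟩ b ⟨hδU hb.2, hb.1⟩
    refine ⟨range γ, isCompact_range γ.continuous, isConnected_range γ.continuous, ?_,
      ⟨0, γ.source⟩, ⟨1, γ.target⟩⟩
    rintro _ ⟨t, rfl⟩
    exact ⟨(hγ t).2, hUε (hγ t).1⟩
  have hε : ∀ n : ℕ, 0 < r / (n + 1) := fun n => by positivity
  choose δ hδ hloc using fun n : ℕ => loc (r / (n + 1)) (hε n)
  have ha : ∀ n : ℕ, ∃ a ∈ Ω, ∀ k ≤ n, a ∈ ball x (δ k) := by
    intro n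
    have ho : IsOpen (⋂ k ∈ Finset.range (n + 1), ball x (δ k)) :=
      isOpen_biInter_finset fun _ _ => isOpen_ball
    obtain ⟨a, ha, haΩ⟩ := mem_closure_iff.1 (frontier_subset_closure hx) _ ho
      (mem_iInter₂.2 fun k _ => mem_ball_self (hδ k))
    exact ⟨a, haΩ, fun k hk => mem_iInter₂.1 ha k (by simpa [Nat.lt_succ_iff] using hk)⟩
  choose a haΩ haδ using ha
  choose K hKc hKp hKs hK0 hK1 using fun n => hloc n (a n) ⟨haΩ n, haδ n n le_rfl⟩ (a (n + 1))
    ⟨haΩ _, haδ _ n n.le_succ⟩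
  have hlim : Tendsto (fun n : ℕ => r / ((n : ℝ) + 1)) atTop (𝓝 0) :=
    tendsto_const_nhds.div_atTop
      (tendsto_atTop_add_const_right _ _ tendsto_natCast_atTop_atTop)
  have hax : Tendsto a atTop (𝓝 x) := by
    rw [tendsto_iff_dist_tendsto_zero]
    exact squeeze_zero (fun _ => dist_nonneg) (fun n => (mem_ball.1 (hKs n (hK0 n)).2).le) hlim
  have hconn : IsConnected (⋃ n, K n) := IsConnected.iUnion_of_chain hKp fun n =>
    ⟨a (n + 1), hK1 n, hK0 (n + 1)⟩
  have hxc : x ∈ closure (⋃ n, K n) :=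
    mem_closure_of_tendsto hax (Eventually.of_forall fun n => mem_iUnion.2 ⟨n, hK0 n⟩)
  have hsub : insert x (⋃ n, K n) ⊆ insert x (Ω ∩ ball x r) := by
    refine insert_subset_insert (iUnion_subset fun n z hz => ⟨(hKs n hz).1, ?_⟩)
    refine ball_subset_ball ?_ (hKs n hz).2
    exact div_le_self hr.le (by linarith [n.cast_nonneg (α := ℝ)])
  have hclosed : IsClosed (insert x (⋃ n, K n)) := by
    rw [← isOpen_compl_iff, isOpen_iff_mem_nhds]
    intro z hz
    have hzx : z ≠ x := fun h => hz (Or.inl h)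
    have hd : 0 < dist z x := dist_pos.2 hzx
    obtain ⟨N, hN⟩ := (hlim.eventually (gt_mem_nhds (half_pos hd))).exists_forall_of_atTop
    have hf : IsClosed (⋃ n ∈ Finset.range N, K n) :=
      isClosed_biUnion_finset fun n _ => (hKc n).isClosed
    filter_upwards [hf.isOpen_compl.mem_nhds (fun h => hz (Or.inr (by
      obtain ⟨n, -, hn⟩ := mem_iUnion₂.1 h
      exact mem_iUnion.2 ⟨n, hn⟩))), ball_mem_nhds z (half_pos hd)] with u hu hub hu'
    rw [mem_ball] at hub
    rcases hu' with rfl | hu'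
    · rw [dist_comm] at hub
      linarith
    · obtain ⟨n, hn⟩ := mem_iUnion.1 hu'
      by_cases hnN : n < N
      · exact hu (mem_iUnion₂.2 ⟨n, by simpa using hnN, hn⟩)
      · have h1 := hN n (not_lt.1 hnN)
        have h2 := mem_ball.1 (hKs n hn).2
        have h3 := dist_triangle_left z x u
        linarith
  refine ⟨insert x (⋃ n, K n), Metric.isCompact_of_isClosed_isBounded hclosed ?_,
    ⟨⟨x, Or.inl rfl⟩, ?_⟩, Or.inl rfl, hsub, a 0, Or.inr (mem_iUnion.2 ⟨0, hK0 0⟩), haΩ 0⟩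
  · exact (isBounded_ball (x := x) (r := r)).subset
      (hsub.trans (insert_subset (mem_ball_self hr) inter_subset_right))
  · exact hconn.isPreconnected.subset_closure (subset_insert _ _)
      (insert_subset hxc subset_closure)

theorem exists_first_mem {X : Type*} [TopologicalSpace X] {σ : ℝ → X} (hσ : Continuous σ)
    {B : Set X} (hB : IsClosed B) {T : ℝ} (hT : 0 ≤ T) (h : σ T ∈ B) :
    ∃ t ∈ Icc 0 T, σ t ∈ B ∧ ∀ s ∈ Ico 0 t, σ s ∉ B := by
  obtain ⟨t, ⟨ht, htB⟩, hmin⟩ := (isCompact_Icc.inter_right (hB.preimage hσ)).exists_isLeast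
    (s := Icc 0 T ∩ σ ⁻¹' B) ⟨T, ⟨hT, le_rfl⟩, h⟩
  exact ⟨t, ht, htB, fun s hs hsB => absurd (hmin ⟨⟨hs.1, hs.2.le.trans ht.2⟩, hsB⟩)
    (not_le.2 hs.2)⟩

/-- Two disjoint continua `A` and `B` in `Ω`, ending at the boundary points `x` and `y`,
together with a segment from `p` to `q` joining them in `Ω`. -/
structure IsCrosscut (Ω : Set ℂ) (x y : ℂ) (A B : Set ℂ) (p q : ℂ) : Prop where
  isCompact_left : IsCompact A
  isCompact_right : IsCompact B
  isConnected_left : IsConnected A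
  isConnected_right : IsConnected B
  disjoint : Disjoint A B
  mem_left : x ∈ A
  mem_right : y ∈ B
  left_subset : A ⊆ insert x Ω
  right_subset : B ⊆ insert y Ω
  source_mem : p ∈ A
  target_mem : q ∈ B
  segment_subset : segment ℝ p q ⊆ Ω
  eq_source : ∀ z ∈ segment ℝ p q, z ∈ A → z = p
  eq_target : ∀ z ∈ segment ℝ p q, z ∈ B → z = q

theorem SimplyConnectedAtBoundary.exists_isCrosscut {Ω : Set ℂ} (H : SimplyConnectedAtBoundary Ω)
    (hΩo : IsOpen Ω) (hΩc : IsConnected Ω) {x y : ℂ} (hx : x ∈ frontier Ω) (hy : y ∈ frontier Ω)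
    (hxy : x ≠ y) : ∃ A B p q, IsCrosscut Ω x y A B p q := by
  have hd : 0 < dist x y / 2 := half_pos (dist_pos.2 hxy)
  obtain ⟨A, hAc, hAp, hxA, hAs, a, haA, haΩ⟩ := H.exists_continuum hΩo hx hd
  obtain ⟨B, hBc, hBp, hyB, hBs, b, hbB, hbΩ⟩ := H.exists_continuum hΩo hy hd
  have hAs' : A ⊆ insert x Ω := hAs.trans (insert_subset_insert inter_subset_left)
  have hBs' : B ⊆ insert y Ω := hBs.trans (insert_subset_insert inter_subset_left)
  have hAB : Disjoint A B :=
    (ball_disjoint_ball (by linarith)).mono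
      (hAs.trans (insert_subset (mem_ball_self hd) inter_subset_right))
      (hBs.trans (insert_subset (mem_ball_self hd) inter_subset_right))
  obtain ⟨γ, hγ⟩ := (hΩo.isConnected_iff_isPathConnected.1 hΩc).joinedIn a haΩ b hbΩ
  set σ : ℝ → ℂ := fun t => γ.extend t
  have hσ : Continuous σ := γ.extend.continuous
  have hσΩ : ∀ t, σ t ∈ Ω := fun t => hγ _
  have hσ0 : σ 0 = a := γ.extend_zero
  have hσ1 : σ 1 = b := γ.extend_one
  obtain ⟨t, ht, htB, htmin⟩ := exists_first_mem hσ hBc.isClosed zero_le_one (hσ1 ▸ hbB)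
  have ht0 : 0 < t := ht.1.lt_of_ne (by
    rintro rfl
    exact hAB.le_bot ⟨haA, hσ0 ▸ htB⟩)
  obtain ⟨ε, hε, hεs⟩ := Metric.nhds_basis_closedBall.mem_iff.1
    ((hΩo.inter hAc.isClosed.isOpen_compl).mem_nhds ⟨hσΩ t, fun h => hAB.le_bot ⟨h, htB⟩⟩)
  obtain ⟨s, hs, hsball⟩ : ∃ s ∈ Ico 0 t, σ s ∈ closedBall (σ t) ε := by
    have h1 : ∀ᶠ s in 𝓝[<] t, σ s ∈ closedBall (σ t) ε :=
      nhdsWithin_le_nhds (hσ.continuousAt.eventually (closedBall_mem_nhds _ hε))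
    obtain ⟨s, hs1, hs2⟩ := (h1.and (Ico_mem_nhdsLT ht0)).exists
    exact ⟨s, hs2, hs1⟩
  obtain ⟨τ, hτ, hτb, hτmin⟩ := exists_first_mem hσ isClosed_closedBall hs.1 hsball
  have hτt : τ < t := hτ.2.trans_lt hs.2
  have hpB : σ τ ∉ B := htmin τ ⟨hτ.1, hτt⟩
  obtain ⟨k, hk, hkB, hkmin⟩ := exists_first_mem (σ := AffineMap.lineMap (σ τ) (σ t))
    (AffineMap.lineMap_continuous (R := ℝ)) hBc.isClosed zero_le_one
    (by rwa [AffineMap.lineMap_apply_one])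
  set q : ℂ := AffineMap.lineMap (σ τ) (σ t) k with hq
  have hseg : ∀ z ∈ segment ℝ (σ τ) q, ∃ l ∈ Icc 0 k, z = AffineMap.lineMap (σ τ) (σ t) l := by
    intro z hz
    rw [segment_eq_image_lineMap] at hz
    obtain ⟨u, hu, rfl⟩ := hz
    refine ⟨u * k, ⟨mul_nonneg hu.1 hk.1, mul_le_of_le_one_left hk.1 hu.2⟩, ?_⟩
    simp [hq, AffineMap.lineMap_apply, mul_assoc]
  have hsegb : segment ℝ (σ τ) q ⊆ closedBall (σ t) ε := by
    refine (convex_closedBall _ _).segment_subset hτb ?_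
    refine (convex_closedBall _ _).segment_subset hτb (mem_closedBall_self hε.le) ?_
    rw [segment_eq_image_lineMap]
    exact ⟨k, hk, rfl⟩
  refine ⟨A ∪ σ '' Icc 0 τ, B, σ τ, q, ⟨hAc.union (isCompact_Icc.image hσ), hBc, ?_, hBp, ?_,
    Or.inl hxA, hyB, union_subset hAs' ?_, hBs', Or.inr ⟨τ, ⟨hτ.1, le_rfl⟩, rfl⟩, hkB,
    fun z hz => (hεs (hsegb hz)).1, ?_, ?_⟩⟩
  · exact IsConnected.union ⟨a, haA, 0, ⟨le_rfl, hτ.1⟩, hσ0⟩ hAp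
      ((isConnected_Icc hτ.1).image σ hσ.continuousOn)
  · rw [disjoint_union_left]
    refine ⟨hAB, disjoint_left.2 ?_⟩
    rintro _ ⟨u, hu, rfl⟩ huB
    exact htmin u ⟨hu.1, hu.2.trans_lt hτt⟩ huB
  · rintro _ ⟨u, -, rfl⟩
    exact Or.inr (hσΩ u)
  · rintro z hz (hzA | ⟨u, hu, rfl⟩)
    · exact ((hεs (hsegb hz)).2 hzA).elim
    · rcases hu.2.lt_or_eq with h | rfl
      · exact (hτmin u ⟨hu.1, h⟩ (hsegb hz)).elim
      · rfl
  · intro z hz hzB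
    obtain ⟨l, hl, rfl⟩ := hseg z hz
    rcases hl.2.lt_or_eq with h | rfl
    · exact (hkmin l ⟨hl.1, h⟩ hzB).elim
    · rfl

theorem div_sub_mem_slitPlane_of_notMem_segment {v w z : ℂ} (h : z ∉ segment ℝ v w) :
    (z - v) / (z - w) ∈ Complex.slitPlane := by
  by_contra hs
  have hzw : z - w ≠ 0 := fun h' => h (sub_eq_zero.1 h' ▸ right_mem_segment ℝ v w)
  rw [Complex.mem_slitPlane_iff, not_or, not_lt, not_not] at hs
  obtain ⟨k, hk0, hk⟩ : ∃ k : ℝ, 0 ≤ k ∧ (z - v) / (z - w) = -(k : ℂ) :=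
    ⟨-((z - v) / (z - w)).re, neg_nonneg.2 hs.1, by
      apply Complex.ext <;> simp [hs.2]⟩
  rw [div_eq_iff hzw] at hk
  have hk1 : (1 + k : ℝ) ≠ 0 := by positivity
  have hk1' : (1 + k : ℂ) ≠ 0 := by exact_mod_cast hk1
  refine h ⟨1 / (1 + k), k / (1 + k), by positivity, by positivity, by field_simp, ?_⟩
  simp only [Complex.real_smul]
  push_cast
  field_simp
  linear_combination -hk

theorem exists_eq_add_mul_of_mem_segment {m d z : ℂ} (hz : z ∈ segment ℝ (m - d) (m + d)) :
    ∃ s : ℝ, z = m + s * d := by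
  obtain ⟨a, b, -, -, hab, rfl⟩ := hz
  refine ⟨b - a, ?_⟩
  have : (a : ℂ) + b = 1 := by exact_mod_cast hab
  simp only [Complex.real_smul]
  push_cast
  linear_combination m * this

/-- A logarithm of `(z - v) / (z - w)` on the line through `m` with direction `d`, where `v` and
`w` are the points `m ± η * I * d`. -/
def crossLog (m d : ℂ) (η : ℝ) (z : ℂ) : ℂ :=
  ((Real.pi + 2 * Real.arctan (((z - m) / d).re / η) : ℝ) : ℂ) * Complex.I

theorem continuous_crossLog (m d : ℂ) (η : ℝ) : Continuous (crossLog m d η) := by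
  unfold crossLog
  fun_prop

theorem crossLog_add_mul {m d : ℂ} (hd : d ≠ 0) (η s : ℝ) :
    crossLog m d η (m + s * d) = ((Real.pi + 2 * Real.arctan (s / η) : ℝ) : ℂ) * Complex.I := by
  simp [crossLog, hd]

theorem exp_two_mul_arctan_mul_I (t : ℝ) :
    Complex.exp ((2 * Real.arctan t : ℝ) * Complex.I)
      = (1 + t * Complex.I) / (1 - t * Complex.I) := by
  have h1 : (1 + t * Complex.I : ℂ) ≠ 0 := fun h => by
    simpa using congrArg Complex.re h
  have h2 : (1 - t * Complex.I : ℂ) ≠ 0 := fun h => by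
    simpa using congrArg Complex.re h
  have h3 : ((2 * Real.arctan t : ℝ) * Complex.I : ℂ)
      = Complex.log ((1 + t * Complex.I) / (1 - t * Complex.I)) := by
    push_cast
    rw [Complex.arctan]
    linear_combination
      -(Complex.log ((1 + t * Complex.I) / (1 - t * Complex.I))) * Complex.I_sq
  rw [h3, Complex.exp_log (div_ne_zero h1 h2)]

theorem exp_crossLog {m d : ℂ} (hd : d ≠ 0) {η : ℝ} (hη : 0 < η) (s : ℝ) :
    Complex.exp (crossLog m d η (m + s * d)) =
      (m + s * d - (m + η * Complex.I * d)) / (m + s * d - (m - η * Complex.I * d)) := by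
  have h2 : (1 - (s / η : ℝ) * Complex.I : ℂ) ≠ 0 := fun h => by
    simpa using congrArg Complex.re h
  have hη' : (η : ℂ) ≠ 0 := by exact_mod_cast hη.ne'
  have h3 : m + s * d - (m - η * Complex.I * d)
      = η * Complex.I * d * (1 - (s / η : ℝ) * Complex.I) := by
    push_cast
    field_simp
    linear_combination s * d * Complex.I_sq
  have h4 : m + s * d - (m + η * Complex.I * d)
      = -(η * Complex.I * d * (1 + (s / η : ℝ) * Complex.I)) := by
    push_cast
    field_simp
    linear_combination s * d * Complex.I_sq
  rw [crossLog_add_mul hd, Complex.ofReal_add, add_mul, Complex.exp_add, Complex.exp_pi_mul_I,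
    exp_two_mul_arctan_mul_I, h3, h4, neg_div, mul_div_mul_left]
  · ring
  · exact mul_ne_zero (mul_ne_zero hη' Complex.I_ne_zero) hd

theorem not_hasLogOn_union_segment {C : Set ℂ} (hC : IsPreconnected C) {m d : ℂ} (hd : d ≠ 0)
    {η : ℝ} (hη : 0 < η) (hp : m - d ∈ C) (hq : m + d ∈ C)
    (hvw : Disjoint C (segment ℝ (m + η * Complex.I * d) (m - η * Complex.I * d))) :
    ¬ HasLogOn (fun z => (z - (m + η * Complex.I * d)) / (z - (m - η * Complex.I * d)))
      (C ∪ segment ℝ (m - d) (m + d)) := by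
  rintro ⟨l, hl, hlf⟩
  have hslit : ∀ z ∈ C, (z - (m + η * Complex.I * d)) / (z - (m - η * Complex.I * d)) ∈
      Complex.slitPlane := fun z hz =>
    div_sub_mem_slitPlane_of_notMem_segment fun h => hvw.le_bot ⟨hz, h⟩
  have e1 := sub_eq_sub_of_exp_eq hC (hl.mono subset_union_left)
    ((continuousOn_div_sub fun h => hvw.le_bot ⟨h, right_mem_segment ℝ _ _⟩).clog hslit)
    (fun z hz => by
      rw [hlf z (Or.inl hz), Complex.exp_log (Complex.slitPlane_ne_zero (hslit z hz))]) hp hq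
  have e2 := sub_eq_sub_of_exp_eq (convex_segment (m - d) (m + d)).isPreconnected
    (hl.mono subset_union_right) (continuous_crossLog m d η).continuousOn
    (fun z hz => by
      rw [hlf z (Or.inr hz)]
      obtain ⟨s, rfl⟩ := exists_eq_add_mul_of_mem_segment hz
      exact (exp_crossLog hd hη s).symm) (left_mem_segment ℝ _ _) (right_mem_segment ℝ _ _)
  have a0 : 0 < Real.arctan (1 / η) := Real.arctan_pos.2 (by positivity)
  have a1 := Real.arctan_lt_pi_div_two (1 / η)
  have hpi := Real.pi_pos
  have him : ∀ t : ℝ, ((t : ℂ) * Complex.I).im = t := fun t => by simp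
  have cp : crossLog m d η (m - d)
      = ((Real.pi - 2 * Real.arctan (1 / η) : ℝ) : ℂ) * Complex.I := by
    have := crossLog_add_mul (m := m) hd η (-1)
    rw [show m + ((-1 : ℝ) : ℂ) * d = m - d by push_cast; ring, neg_div, Real.arctan_neg] at this
    rw [this]
    push_cast
    ring
  have cq : crossLog m d η (m + d)
      = ((Real.pi + 2 * Real.arctan (1 / η) : ℝ) : ℂ) * Complex.I := by
    have := crossLog_add_mul (m := m) hd η 1
    rwa [show m + ((1 : ℝ) : ℂ) * d = m + d by push_cast; ring] at this
  have lp : Complex.log (((m - d) - (m + η * Complex.I * d)) / ((m - d) - (m - η * Complex.I * d)))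
      = ((Real.pi - 2 * Real.arctan (1 / η) : ℝ) : ℂ) * Complex.I := by
    have := exp_crossLog (m := m) hd hη (-1)
    rw [show m + ((-1 : ℝ) : ℂ) * d = m - d by push_cast; ring] at this
    rw [← this, cp, Complex.log_exp]
    · rw [him]
      linarith
    · rw [him]
      linarith
  have lq : Complex.log (((m + d) - (m + η * Complex.I * d)) / ((m + d) - (m - η * Complex.I * d)))
      = ((2 * Real.arctan (1 / η) - Real.pi : ℝ) : ℂ) * Complex.I := by
    have := exp_crossLog (m := m) hd hη 1
    rw [show m + ((1 : ℝ) : ℂ) * d = m + d by push_cast; ring] at this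
    have e : Complex.exp (((Real.pi + 2 * Real.arctan (1 / η) : ℝ) : ℂ) * Complex.I)
        = Complex.exp (((2 * Real.arctan (1 / η) - Real.pi : ℝ) : ℂ) * Complex.I) := by
      rw [Complex.exp_eq_exp_iff_exists_int]
      refine ⟨1, ?_⟩
      push_cast
      ring
    rw [← this, cq, e, Complex.log_exp]
    · rw [him]
      linarith
    · rw [him]
      linarith
  simp only [lp, lq] at e1
  rw [cp, cq] at e2
  have e3 : ((Real.pi - 2 * Real.arctan (1 / η) : ℝ) : ℂ) * Complex.I -
      ((2 * Real.arctan (1 / η) - Real.pi : ℝ) : ℂ) * Complex.I =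
      ((Real.pi - 2 * Real.arctan (1 / η) : ℝ) : ℂ) * Complex.I -
      ((Real.pi + 2 * Real.arctan (1 / η) : ℝ) : ℂ) * Complex.I := by
    linear_combination e2 - e1
  have e4 := congrArg Complex.im e3
  simp only [Complex.sub_im, him] at e4
  linarith

theorem isCompact_segment_complex (a b : ℂ) : IsCompact (segment ℝ a b) := by
  rw [segment_eq_image_lineMap]
  exact isCompact_Icc.image (AffineMap.lineMap_continuous (R := ℝ))

theorem IsCrosscut.hasLogOn {Ω : Set ℂ} (hΩo : IsOpen Ω) (hΩc : IsPreconnected Ω) {x y : ℂ}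
    (hx : x ∈ frontier Ω) (hy : y ∈ frontier Ω)
    {A B : Set ℂ} {m d : ℂ} (h : IsCrosscut Ω x y A B (m - d) (m + d)) (hd : d ≠ 0)
    {η : ℝ} (hη : 0 < η)
    (hvw : segment ℝ (m + η * Complex.I * d) (m - η * Complex.I * d) ⊆ Ω \ (A ∪ B))
    {F₁ F₂ : Set ℂ} (h1 : IsClosed F₁) (h2 : IsClosed F₂) (h1f : F₁ ⊆ frontier Ω)
    (h2f : F₂ ⊆ frontier Ω) (hF : Disjoint F₁ F₂) (hyF : y ∉ F₁) (hxF : x ∉ F₂) :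
    HasLogOn (fun z => (z - (m + η * Complex.I * d)) / (z - (m - η * Complex.I * d)))
      (F₁ ∪ A ∪ segment ℝ (m - d) (m + d) ∪ B ∪ F₂) := by
  have hΩf : Disjoint Ω (frontier Ω) := by
    rw [hΩo.frontier_eq]
    exact disjoint_sdiff_right
  have hsc : IsClosed (segment ℝ (m - d) (m + d)) :=
    (isCompact_segment_complex _ _).isClosed
  have hv := left_mem_segment ℝ (m + η * Complex.I * d) (m - η * Complex.I * d)
  have hw := right_mem_segment ℝ (m + η * Complex.I * d) (m - η * Complex.I * d)
  have lF : ∀ F, IsClosed F → F ⊆ frontier Ω →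
      HasLogOn (fun z => (z - (m + η * Complex.I * d)) / (z - (m - η * Complex.I * d))) F :=
    fun F hF hFf => hasLogOn_of_isPreconnected hF hΩc (hΩf.mono_right hFf) (hvw hv).1 (hvw hw).1
  have lA : ∀ D, IsClosed D → D ⊆ A ∪ B →
      HasLogOn (fun z => (z - (m + η * Complex.I * d)) / (z - (m - η * Complex.I * d))) D :=
    fun D hD hDs => hasLogOn_of_isPreconnected hD (convex_segment _ _).isPreconnected
      (disjoint_left.2 fun z hz hzD => (hvw hz).2 (hDs hzD)) hv hw
  have lS : HasLogOn (fun z => (z - (m + η * Complex.I * d)) / (z - (m - η * Complex.I * d)))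
      (segment ℝ (m - d) (m + d)) :=
    ⟨crossLog m d η, (continuous_crossLog m d η).continuousOn, fun z hz => by
      obtain ⟨s, rfl⟩ := exists_eq_add_mul_of_mem_segment hz
      exact exp_crossLog hd hη s⟩
  have hAc := h.isCompact_left.isClosed
  have hBc := h.isCompact_right.isClosed
  have hxΩ : x ∉ Ω := fun h => hΩf.le_bot ⟨h, hx⟩
  have hyΩ : y ∉ Ω := fun h => hΩf.le_bot ⟨h, hy⟩
  have fA : ∀ z ∈ frontier Ω, z ∈ A → z = x := fun z hz hzA =>
    (h.left_subset hzA).resolve_right fun h => hΩf.le_bot ⟨h, hz⟩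
  have fB : ∀ z ∈ frontier Ω, z ∈ B → z = y := fun z hz hzB =>
    (h.right_subset hzB).resolve_right fun h => hΩf.le_bot ⟨h, hz⟩
  have fS : ∀ z ∈ frontier Ω, z ∉ segment ℝ (m - d) (m + d) := fun z hz hzS =>
    hΩf.le_bot ⟨h.segment_subset hzS, hz⟩
  have pre : ∀ (E : Set ℂ) (a : ℂ), (∀ z ∈ E, z = a) → IsPreconnected E := fun E a hE =>
    (subsingleton_singleton.anti (show E ⊆ {a} from hE)).isPreconnected
  refine HasLogOn.union (((h1.union hAc).union hsc).union hBc) h2 (HasLogOn.union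
    ((h1.union hAc).union hsc) hBc (HasLogOn.union (h1.union hAc) hsc (HasLogOn.union h1 hAc
    (lF _ h1 h1f) (lA _ hAc subset_union_left) (pre _ x ?_)) lS (pre _ (m - d) ?_))
    (lA _ hBc subset_union_right) (pre _ (m + d) ?_)) (lF _ h2 h2f) (pre _ y ?_)
  · exact fun z hz => fA z (h1f hz.1) hz.2
  · rintro z ⟨hz | hz, hzS⟩
    · exact (fS z (h1f hz) hzS).elim
    · exact h.eq_source z hzS hz
  · rintro z ⟨(hz | hz) | hz, hzB⟩
    · exact (hyF (fB z (h1f hz) hzB ▸ hz)).elim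
    · exact (h.disjoint.le_bot ⟨hz, hzB⟩).elim
    · exact h.eq_target z hz hzB
  · rintro z ⟨((hz | hz) | hz) | hz, hzF⟩
    · exact (hF.le_bot ⟨hz, hzF⟩).elim
    · exact (hxF (fA z (h2f hzF) hz ▸ hzF)).elim
    · exact (fS z (h2f hzF) hz).elim
    · exact fB z (h2f hzF) hz

theorem mem_connectedComponentIn_closure_inter {K γ : Set ℂ} (hK : IsCompact K) (hγ : IsCompact γ)
    {v w x y : ℂ} (hv : v ∉ K ∪ γ) (hw : w ∉ K ∪ γ)
    (hvw : w ∉ connectedComponentIn (K ∪ γ)ᶜ v)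
    (hlog : ∀ F₁ F₂, IsClosed F₁ → IsClosed F₂ → F₁ ⊆ K → F₂ ⊆ K → Disjoint F₁ F₂ → y ∉ F₁ →
      x ∉ F₂ → HasLogOn (fun z => (z - v) / (z - w)) (γ ∪ (F₁ ∪ F₂))) :
    y ∈ connectedComponentIn (closure (connectedComponentIn (K ∪ γ)ᶜ v) ∩ K) x := by
  set G := connectedComponentIn (K ∪ γ)ᶜ v with hG
  set F := closure G ∩ K with hFdef
  have hF : IsCompact F := hK.inter_left isClosed_closure
  have hvG : v ∈ G := mem_connectedComponentIn hv
  have hsep : w ∉ connectedComponentIn (γ ∪ F)ᶜ v := by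
    intro h
    have hvF : v ∈ (γ ∪ F)ᶜ := fun h => hv (h.elim Or.inr fun h => Or.inl h.2)
    refine hvw (IsPreconnected.subset_of_disjoint_frontier isPreconnected_connectedComponentIn
      (disjoint_left.2 fun z hz hzf => ?_) ⟨v, mem_connectedComponentIn hvF, hvG⟩ h)
    refine connectedComponentIn_subset _ _ hz ?_
    rcases frontier_connectedComponentIn_compl_subset (hK.union hγ).isClosed v hzf with h | h
    · exact Or.inr ⟨frontier_subset_closure hzf, h⟩
    · exact Or.inl h
  have key : ∀ F₁ F₂, IsClosed F₁ → IsClosed F₂ → F₁ ∪ F₂ = F → Disjoint F₁ F₂ → y ∉ F₁ →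
      x ∉ F₂ → False := by
    intro F₁ F₂ h1 h2 h12 hd hy hx
    have hs : F₁ ∪ F₂ ⊆ K := h12 ▸ inter_subset_right
    have hl := hlog F₁ F₂ h1 h2 (subset_union_left.trans hs) (subset_union_right.trans hs) hd hy hx
    rw [h12] at hl
    exact hsep (mem_connectedComponentIn_of_hasLogOn (hγ.union hF)
      (fun h => hv (h.elim Or.inr fun h => Or.inl h.2))
      (fun h => hw (h.elim Or.inr fun h => Or.inl h.2)) hl)
  have hxF : x ∈ F := by
    by_contra h
    exact key ∅ F isClosed_empty hF.isClosed (empty_union _) (disjoint_bot_left) (by simp) h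
  by_contra hy
  obtain ⟨W, hWF, hWc, hWd, hxW, hW⟩ := exists_isClosed_disjoint_of_connectedComponentIn hF hxF
    (isClosed_singleton (x := y)) (disjoint_singleton_left.2 hy)
  exact key W (F \ W) hWc hWd (union_sdiff_cancel hWF) disjoint_sdiff_right
    (disjoint_singleton_right.1 hW) (fun h => h.2 hxW)

/-- Two points in the same component of the boundary cut it into two sides: a closed set `F`, and
the rest, each of which contains a connected set joining the two points. -/
theorem SimplyConnectedAtBoundary.exists_side {Ω : Set ℂ} (H : SimplyConnectedAtBoundary Ω)
    (hΩo : IsOpen Ω) (hΩc : IsConnected Ω) (hb : Bornology.IsBounded Ω) {x y : ℂ}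
    (hx : x ∈ frontier Ω) (hxy : x ≠ y) (hyQ : y ∈ connectedComponentIn (frontier Ω) x) :
    ∃ F Z Z' : Set ℂ, IsClosed F ∧ F ⊆ frontier Ω ∧ IsClosed (frontier Ω \ F ∪ {x, y}) ∧
      Z ⊆ F ∧ Z' ⊆ frontier Ω ∧ Z' ∩ F ⊆ {x, y} ∧ IsPreconnected Z ∧ IsPreconnected Z' ∧
      x ∈ Z ∧ y ∈ Z ∧ x ∈ Z' ∧ y ∈ Z' := by
  have hy : y ∈ frontier Ω := connectedComponentIn_subset _ _ hyQ
  obtain ⟨A, B, p, q, hc⟩ := H.exists_isCrosscut hΩo hΩc hx hy hxy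
  have hpq : p ≠ q := fun h => hc.disjoint.le_bot ⟨hc.source_mem, h ▸ hc.target_mem⟩
  obtain ⟨m, d, rfl, rfl⟩ : ∃ m d : ℂ, p = m - d ∧ q = m + d :=
    ⟨(p + q) / 2, (q - p) / 2, by ring, by ring⟩
  have hd : d ≠ 0 := by
    rintro rfl
    simp at hpq
  set K := frontier Ω with hKdef
  have hK : IsCompact K := hb.isCompact_closure.of_isClosed_subset isClosed_frontier
    frontier_subset_closure
  have hΩK : Disjoint Ω K := by
    rw [hKdef, hΩo.frontier_eq]
    exact disjoint_sdiff_right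
  set γ := A ∪ segment ℝ (m - d) (m + d) ∪ B with hγdef
  have hγc : IsCompact γ := (hc.isCompact_left.union (isCompact_segment_complex _ _)).union
    hc.isCompact_right
  have hγK : ∀ z ∈ γ, z ∈ K → z = x ∨ z = y := by
    rintro z ((hz | hz) | hz) hzK
    · exact Or.inl ((hc.left_subset hz).resolve_right fun h => hΩK.le_bot ⟨h, hzK⟩)
    · exact (hΩK.le_bot ⟨hc.segment_subset hz, hzK⟩).elim
    · exact Or.inr ((hc.right_subset hz).resolve_right fun h => hΩK.le_bot ⟨h, hzK⟩)
  have hmS : m ∈ segment ℝ (m - d) (m + d) :=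
    ⟨1 / 2, 1 / 2, by norm_num, by norm_num, by norm_num, by
      simp only [Complex.real_smul]
      push_cast
      ring⟩
  have hmA : m ∉ A := fun h => hd (by linear_combination hc.eq_source m hmS h)
  have hmB : m ∉ B := fun h => hd (by linear_combination -hc.eq_target m hmS h)
  obtain ⟨ε, hε, hεs⟩ := Metric.isOpen_iff.1
    (hΩo.sdiff (hc.isCompact_left.union hc.isCompact_right).isClosed) m
    ⟨hc.segment_subset hmS, fun h => h.elim hmA hmB⟩
  obtain ⟨η, hη, hηε⟩ : ∃ η : ℝ, 0 < η ∧ η * ‖d‖ < ε := by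
    have hd' := norm_pos_iff.2 hd
    refine ⟨ε / 2 / ‖d‖, by positivity, ?_⟩
    rw [div_mul_cancel₀ _ hd'.ne']
    linarith
  set v := m + η * Complex.I * d with hvdef
  set w := m - η * Complex.I * d with hwdef
  have hvw : segment ℝ v w ⊆ Ω \ (A ∪ B) := by
    refine ((convex_ball m ε).segment_subset ?_ ?_).trans hεs
    · simp [hvdef, abs_of_pos hη, hηε]
    · simp [hwdef, abs_of_pos hη, hηε]
  have hnS : ∀ t : ℝ, t ≠ 0 → m + t * Complex.I * d ∉ segment ℝ (m - d) (m + d) := by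
    intro t ht h
    obtain ⟨s, hs⟩ := exists_eq_add_mul_of_mem_segment h
    have h1 : (t : ℂ) * Complex.I = s := mul_right_cancel₀ hd (add_left_cancel hs)
    exact ht (by simpa using congrArg Complex.im h1)
  have hout : ∀ u ∈ segment ℝ v w, u ∉ segment ℝ (m - d) (m + d) → u ∉ K ∪ γ := by
    rintro u hu huS (h | (h | h) | h)
    · exact hΩK.le_bot ⟨(hvw hu).1, h⟩
    · exact (hvw hu).2 (Or.inl h)
    · exact huS h
    · exact (hvw hu).2 (Or.inr h)
  have hv : v ∉ K ∪ γ := hout v (left_mem_segment ℝ _ _) (hnS η hη.ne')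
  have hw : w ∉ K ∪ γ := hout w (right_mem_segment ℝ _ _) (by
    have := hnS (-η) (neg_ne_zero.2 hη.ne')
    rwa [show m + ((-η : ℝ) : ℂ) * Complex.I * d = w by rw [hwdef]; push_cast; ring] at this)
  have hsep : w ∉ connectedComponentIn (K ∪ γ)ᶜ v := by
    intro hwv
    have hlog := hasLogOn_of_isPreconnected (hK.union hγc).isClosed
      isPreconnected_connectedComponentIn
      (disjoint_left.2 fun z hz => connectedComponentIn_subset (K ∪ γ)ᶜ v hz)
      (mem_connectedComponentIn hv) hwv
    have hC : IsPreconnected (connectedComponentIn K x ∪ A ∪ B) :=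
      IsPreconnected.union y (Or.inl hyQ) hc.mem_right
        (IsPreconnected.union x (mem_connectedComponentIn hx) hc.mem_left
          isPreconnected_connectedComponentIn hc.isConnected_left.isPreconnected)
        hc.isConnected_right.isPreconnected
    refine not_hasLogOn_union_segment hC hd hη (Or.inl (Or.inr hc.source_mem))
      (Or.inr hc.target_mem) (disjoint_left.2 ?_) (hlog.mono ?_)
    · rintro z ((hz | hz) | hz) hzs
      · exact hΩK.le_bot ⟨(hvw hzs).1, connectedComponentIn_subset _ _ hz⟩
      · exact (hvw hzs).2 (Or.inl hz)
      · exact (hvw hzs).2 (Or.inr hz)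
    · rintro z (((hz | hz) | hz) | hz)
      · exact Or.inl (connectedComponentIn_subset _ _ hz)
      · exact Or.inr (Or.inl (Or.inl hz))
      · exact Or.inr (Or.inr hz)
      · exact Or.inr (Or.inl (Or.inr hz))
  have hsep' : v ∉ connectedComponentIn (K ∪ γ)ᶜ w := fun h =>
    hsep (connectedComponentIn_eq h ▸ mem_connectedComponentIn hw)
  have hlog : ∀ F₁ F₂, IsClosed F₁ → IsClosed F₂ → F₁ ⊆ K → F₂ ⊆ K → Disjoint F₁ F₂ → y ∉ F₁ →
      x ∉ F₂ → HasLogOn (fun z => (z - v) / (z - w)) (γ ∪ (F₁ ∪ F₂)) := by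
    intro F₁ F₂ h1 h2 h1f h2f hF hyF hxF
    refine (hc.hasLogOn hΩo hΩc.isPreconnected hx hy hd hη hvw h1 h2 h1f h2f hF hyF hxF).mono ?_
    rintro z (((hz | hz) | hz) | hz | hz)
    · exact Or.inl (Or.inl (Or.inl (Or.inr hz)))
    · exact Or.inl (Or.inl (Or.inr hz))
    · exact Or.inl (Or.inr hz)
    · exact Or.inl (Or.inl (Or.inl (Or.inl hz)))
    · exact Or.inr hz
  have hG : ∀ u ∈ Ω, u ∉ K ∪ γ → connectedComponentIn (K ∪ γ)ᶜ u ⊆ Ω := fun u huΩ hu =>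
    IsPreconnected.subset_of_disjoint_frontier isPreconnected_connectedComponentIn
      (disjoint_left.2 fun z hz h => connectedComponentIn_subset _ _ hz (Or.inl h))
      ⟨u, mem_connectedComponentIn hu, huΩ⟩
  have hGv := hG v (hvw (left_mem_segment ℝ _ _)).1 hv
  have hGw := hG w (hvw (right_mem_segment ℝ _ _)).1 hw
  have hZ := mem_connectedComponentIn_closure_inter hK hγc hv hw hsep hlog
  have hZ' := mem_connectedComponentIn_closure_inter hK hγc hw hv hsep'
    (fun F₁ F₂ h1 h2 h1f h2f hF hyF hxF => (hlog F₁ F₂ h1 h2 h1f h2f hF hyF hxF).inv.congr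
      fun z _ => by simp)
  set Gv := connectedComponentIn (K ∪ γ)ᶜ v
  set Gw := connectedComponentIn (K ∪ γ)ᶜ w
  have loc : ∀ z ∈ K, z ≠ x → z ≠ y → ∃ U, IsOpen U ∧ z ∈ U ∧ Disjoint U γ ∧
      IsConnected (U ∩ Ω) ∧ ∀ u, ((U ∩ Ω) ∩ connectedComponentIn (K ∪ γ)ᶜ u).Nonempty →
        U ∩ Ω ⊆ connectedComponentIn (K ∪ γ)ᶜ u := by
    intro z hz hzx hzy
    obtain ⟨r, hr, hrγ⟩ := Metric.isOpen_iff.1 hγc.isClosed.isOpen_compl z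
      (fun h => (hγK z h hz).elim hzx hzy)
    obtain ⟨U, hU, hzU, hUr, hUc⟩ := H z hz r hr
    refine ⟨U, hU, hzU, disjoint_left.2 fun u hu => hrγ (hUr hu), hUc, ?_⟩
    rintro u ⟨t, ht, htu⟩
    rw [connectedComponentIn_eq htu]
    refine hUc.isPreconnected.subset_connectedComponentIn ht ?_
    rintro s ⟨hsU, hsΩ⟩ (h | h)
    · exact hΩK.le_bot ⟨hsΩ, h⟩
    · exact hrγ (hUr hsU) h
  have meets : ∀ u, connectedComponentIn (K ∪ γ)ᶜ u ⊆ Ω → ∀ U, IsOpen U → ∀ z ∈ U,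
      z ∈ closure (connectedComponentIn (K ∪ γ)ᶜ u) →
      ((U ∩ Ω) ∩ connectedComponentIn (K ∪ γ)ᶜ u).Nonempty := by
    intro u hu U hU z hz hzc
    obtain ⟨t, htU, ht⟩ := mem_closure_iff.1 hzc U hU hz
    exact ⟨t, ⟨htU, hu ht⟩, ht⟩
  have hxF : x ∈ closure Gv ∩ K := by
    by_contra h
    rw [connectedComponentIn_eq_empty h] at hZ
    exact hZ
  have hxF' : x ∈ closure Gw ∩ K := by
    by_contra h
    rw [connectedComponentIn_eq_empty h] at hZ'
    exact hZ'
  refine ⟨closure Gv ∩ K, _, _, isClosed_closure.inter hK.isClosed, inter_subset_right, ?_,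
    connectedComponentIn_subset _ _, (connectedComponentIn_subset _ _).trans inter_subset_right,
    ?_, isPreconnected_connectedComponentIn, isPreconnected_connectedComponentIn,
    mem_connectedComponentIn hxF, hZ, mem_connectedComponentIn hxF', hZ'⟩
  · have hEK : K \ (closure Gv ∩ K) ∪ {x, y} ⊆ K :=
      union_subset sdiff_subset (insert_subset hx (singleton_subset_iff.2 hy))
    refine isClosed_of_closure_subset fun z hz => ?_
    have hzK : z ∈ K := closure_minimal hEK hK.isClosed hz
    by_contra hzE
    have hzxy : z ≠ x ∧ z ≠ y := by
      constructor <;> rintro rfl <;> exact hzE (Or.inr (by simp))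
    have hzF : z ∈ closure Gv := by
      by_contra h
      exact hzE (Or.inl ⟨hzK, fun h' => h h'.1⟩)
    obtain ⟨U, hU, hzU, hUγ, -, hUu⟩ := loc z hzK hzxy.1 hzxy.2
    have hUG := hUu v (meets v hGv U hU z hzU hzF)
    obtain ⟨e, heU, he⟩ := mem_closure_iff.1 hz U hU hzU
    rcases he with ⟨heK, he⟩ | rfl | rfl
    · refine he ⟨mem_closure_iff.2 fun N hN heN => ?_, heK⟩
      obtain ⟨t, ht, htΩ⟩ := mem_closure_iff.1 (frontier_subset_closure heK) _ (hN.inter hU)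
        ⟨heN, heU⟩
      exact ⟨t, ht.1, hUG ⟨ht.2, htΩ⟩⟩
    · exact hUγ.le_bot ⟨heU, Or.inl (Or.inl hc.mem_left)⟩
    · exact hUγ.le_bot ⟨heU, Or.inr hc.mem_right⟩
  · rintro z ⟨hz', hz, -⟩
    obtain ⟨hz'', hzK⟩ := connectedComponentIn_subset _ _ hz'
    by_contra hzxy
    rw [mem_insert_iff, mem_singleton_iff, not_or] at hzxy
    obtain ⟨U, hU, hzU, -, ⟨⟨t, ht⟩, -⟩, hUu⟩ := loc z hzK hzxy.1 hzxy.2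
    have h1 := hUu v (meets v hGv U hU z hzU hz) ht
    have h2 := hUu w (meets w hGw U hU z hzU hz'') ht
    apply hsep
    change w ∈ connectedComponentIn (K ∪ γ)ᶜ v
    rw [connectedComponentIn_eq h1, ← connectedComponentIn_eq h2]
    exact mem_connectedComponentIn hw

theorem isPreconnected_compl_of_union_eq_compl_singleton {X : Type*} [TopologicalSpace X]
    [PreconnectedSpace X] {U V : Set X} {y : X} (hU : IsOpen U) (hV : IsOpen V)
    (hd : Disjoint U V) (h : U ∪ V = {y}ᶜ) : IsPreconnected Vᶜ := by
  have hyV : y ∈ Vᶜ := fun hy => (h.subset (Or.inr hy)) rfl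
  have key : ∀ u v : Set X, IsClosed u → IsClosed v → Vᶜ ⊆ u ∪ v → Disjoint u v → y ∈ u →
      Vᶜ ⊆ u := by
    intro u v hu hv huv hduv hy
    have h1 : (univ : Set X) ⊆ V ∪ vᶜ := by
      refine isPreconnected_univ.subset_right_of_subset_union (u := U ∩ uᶜ)
        (hU.inter hu.isOpen_compl) (hV.union hv.isOpen_compl) ?_ ?_ ⟨y, trivial, Or.inr ?_⟩
      · rw [disjoint_left]
        rintro z ⟨hzU, hzu⟩ (hz | hz)
        · exact hd.le_bot ⟨hzU, hz⟩
        · exact hz ((huv fun hzV => hd.le_bot ⟨hzU, hzV⟩).resolve_left hzu)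
      · intro z _
        by_cases hzV : z ∈ V
        · exact Or.inr (Or.inl hzV)
        by_cases hzv : z ∈ v
        · refine Or.inl ⟨?_, fun hzu => hduv.le_bot ⟨hzu, hzv⟩⟩
          have : z ∈ U ∪ V := by
            rw [h]
            rintro rfl
            exact hduv.le_bot ⟨hy, hzv⟩
          exact this.resolve_right hzV
        · exact Or.inr (Or.inr hzv)
      · exact fun hyv => hduv.le_bot ⟨hy, hyv⟩
    intro z hz
    exact (huv hz).resolve_right ((h1 trivial).resolve_left hz)
  rw [isPreconnected_iff_subset_of_fully_disjoint_closed hV.isClosed_compl]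
  intro u v hu hv huv hduv
  rcases huv hyV with hy | hy
  · exact Or.inl (key u v hu hv huv hduv hy)
  · exact Or.inr (key v u hv hu (by rwa [union_comm]) hduv.symm hy)

/-- Every point separates the space, with `p` and `q` on the two (possibly degenerate) sides. -/
structure IsCutSystem {X : Type*} [TopologicalSpace X] (p q : X) (P Q : X → Set X) : Prop where
  isOpen_left : ∀ y, IsOpen (P y)
  isOpen_right : ∀ y, IsOpen (Q y)
  disjoint : ∀ y, Disjoint (P y) (Q y)
  union_eq : ∀ y, P y ∪ Q y = {y}ᶜ
  notMem_left : ∀ y, q ∉ P y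
  notMem_right : ∀ y, p ∉ Q y

namespace IsCutSystem

section Topological

variable {X : Type*} [TopologicalSpace X] {p q : X} {P Q : X → Set X}

theorem symm (h : IsCutSystem p q P Q) : IsCutSystem q p Q P :=
  ⟨h.isOpen_right, h.isOpen_left, fun y => (h.disjoint y).symm,
    fun y => by rw [union_comm, h.union_eq], h.notMem_right, h.notMem_left⟩

theorem self_notMem_left (h : IsCutSystem p q P Q) (y : X) : y ∉ P y := fun hy =>
  (h.union_eq y).subset (Or.inl hy) rfl

theorem self_notMem_right (h : IsCutSystem p q P Q) (y : X) : y ∉ Q y := h.symm.self_notMem_left y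

theorem mem_or_mem (h : IsCutSystem p q P Q) {y z : X} (hyz : z ≠ y) : z ∈ P y ∨ z ∈ Q y :=
  (h.union_eq y).superset hyz

theorem compl_right_subset [PreconnectedSpace X] (h : IsCutSystem p q P Q) {y z : X}
    (hz : z ∈ Q y) : (Q y)ᶜ ⊆ P z := by
  refine (isPreconnected_compl_of_union_eq_compl_singleton (h.isOpen_left y) (h.isOpen_right y)
    (h.disjoint y) (h.union_eq y)).subset_left_of_subset_union (h.isOpen_left z) (h.isOpen_right z)
    (h.disjoint z) (fun w hw => ?_) ⟨p, h.notMem_right y, ?_⟩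
  · refine h.mem_or_mem ?_
    rintro rfl
    exact hw hz
  · refine (h.mem_or_mem ?_).resolve_right (h.notMem_right z)
    rintro rfl
    exact h.notMem_right y hz

theorem mem_left_iff [PreconnectedSpace X] (h : IsCutSystem p q P Q) {y z : X} :
    y ∈ P z ↔ z ∈ Q y :=
  ⟨fun hy => h.symm.compl_right_subset hy (h.self_notMem_left z),
    fun hz => h.compl_right_subset hz (h.self_notMem_right y)⟩

theorem exists_between [PreconnectedSpace X] (h : IsCutSystem p q P Q) {y z : X} (hz : z ∈ Q y) :
    (Q y ∩ P z).Nonempty := by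
  have := isPreconnected_univ (Q y) (P z) (h.isOpen_right y) (h.isOpen_left z) (fun w _ => by
    by_cases hw : w ∈ Q y
    · exact Or.inl hw
    · exact Or.inr (h.compl_right_subset hz hw)) ⟨z, trivial, hz⟩
    ⟨y, trivial, h.mem_left_iff.2 hz⟩
  rwa [univ_inter] at this

theorem isClosed_setOf_notMem_right [PreconnectedSpace X] (h : IsCutSystem p q P Q) :
    IsClosed {w : X × X | w.1 ∉ Q w.2} := by
  rw [← isOpen_compl_iff, isOpen_iff_mem_nhds]
  rintro ⟨z, y⟩ hzy
  have hz : z ∈ Q y := not_not.1 hzy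
  obtain ⟨t, hty, htz⟩ := h.exists_between hz
  refine mem_of_superset (prod_mem_nhds ((h.isOpen_right t).mem_nhds (h.mem_left_iff.1 htz))
    ((h.isOpen_left t).mem_nhds (h.mem_left_iff.2 hty))) ?_
  rintro ⟨z', y'⟩ ⟨hz', hy'⟩ hn
  exact (h.disjoint t).le_bot ⟨h.compl_right_subset (h.mem_left_iff.1 hy') hn, hz'⟩

end Topological

variable {X : Type*} [MetricSpace X] [CompactSpace X] [PreconnectedSpace X] {p q : X}
  {P Q : X → Set X}

theorem continuous_infDist (h : IsCutSystem p q P Q) (d : X) :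
    Continuous fun y => infDist d (Q y)ᶜ := by
  have hne : ∀ y, ((Q y)ᶜ).Nonempty := fun y => ⟨y, h.self_notMem_right y⟩
  rw [OrderTopology.continuous_iff]
  intro a
  constructor
  · have : (fun y => infDist d (Q y)ᶜ) ⁻¹' Ioi a
        = (Prod.snd '' ({w : X × X | w.1 ∉ Q w.2} ∩ {w | dist d w.1 ≤ a}))ᶜ := by
      ext y
      rw [mem_preimage, mem_Ioi, ← not_le, mem_compl_iff, not_iff_not]
      constructor
      · intro hy
        obtain ⟨z, hz, hzd⟩ := (h.isOpen_right y).isClosed_compl.isCompact.exists_infDist_eq_dist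
          (hne y) d
        exact ⟨(z, y), ⟨hz, (hzd ▸ hy : dist d z ≤ a)⟩, rfl⟩
      · rintro ⟨⟨z, y⟩, ⟨hz, hzd⟩, rfl⟩
        exact (infDist_le_dist_of_mem (show z ∈ (Q y)ᶜ from hz)).trans (show dist d z ≤ a from hzd)
    rw [this, isOpen_compl_iff]
    refine (IsCompact.image ?_ continuous_snd).isClosed
    exact (h.isClosed_setOf_notMem_right.inter
      (isClosed_le (by fun_prop) continuous_const)).isCompact
  · rw [isOpen_iff_mem_nhds]
    intro y hy
    obtain ⟨z, hz, hzd⟩ := (infDist_lt_iff (hne y)).1 hy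
    by_cases hzy : z = y
    · subst hzy
      filter_upwards [(isOpen_lt (continuous_const.dist continuous_id)
        continuous_const).mem_nhds hzd] with w hw
      exact (infDist_le_dist_of_mem (h.self_notMem_right w)).trans_lt hw
    · have hzP := (h.mem_or_mem hzy).resolve_right hz
      filter_upwards [(h.isOpen_right z).mem_nhds (h.mem_left_iff.1 hzP)] with w hw
      exact (infDist_le_dist_of_mem (show z ∈ (Q w)ᶜ from
        fun hzw => (h.disjoint w).le_bot ⟨h.mem_left_iff.2 hw, hzw⟩)).trans_lt hzd

theorem exists_strictAnti [Nonempty X] (h : IsCutSystem p q P Q) :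
    ∃ f : X → ℝ, Continuous f ∧ ∀ y, ∀ z ∈ Q y, f z < f y := by
  have hne : ∀ y, ((Q y)ᶜ).Nonempty := fun y => ⟨y, h.self_notMem_right y⟩
  set d : ℕ → X := TopologicalSpace.denseSeq X
  have hd : DenseRange d := TopologicalSpace.denseRange_denseSeq X
  have hbd : ∀ (n : ℕ) (y : X), (1 / 2 : ℝ) ^ n * infDist (d n) (Q y)ᶜ
      ≤ (1 / 2 : ℝ) ^ n * diam (univ : Set X) := fun n y =>
    mul_le_mul_of_nonneg_left ((infDist_le_dist_of_mem (h.self_notMem_right y)).trans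
      (dist_le_diam_of_mem isCompact_univ.isBounded trivial trivial)) (by positivity)
  have h0 : ∀ (n : ℕ) (y : X), 0 ≤ (1 / 2 : ℝ) ^ n * infDist (d n) (Q y)ᶜ := fun n y =>
    mul_nonneg (by positivity) infDist_nonneg
  have hs : Summable fun n : ℕ => (1 / 2 : ℝ) ^ n * diam (univ : Set X) :=
    summable_geometric_two.mul_right _
  refine ⟨fun y => ∑' n, (1 / 2 : ℝ) ^ n * infDist (d n) (Q y)ᶜ,
    continuous_tsum (fun n => continuous_const.mul (h.continuous_infDist (d n))) hs
      fun n y => by rw [Real.norm_of_nonneg (h0 n y)]; exact hbd n y, fun y z hz => ?_⟩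
  have hsum : ∀ y, Summable fun n : ℕ => (1 / 2 : ℝ) ^ n * infDist (d n) (Q y)ᶜ := fun y =>
    hs.of_nonneg_of_le (fun n => h0 n y) fun n => hbd n y
  obtain ⟨n, hn1, hn2⟩ := hd.exists_mem_open ((h.isOpen_right y).inter (h.isOpen_left z))
    (h.exists_between hz)
  have hsub : (Q y)ᶜ ⊆ (Q z)ᶜ := fun w hw hwz =>
    (h.disjoint z).le_bot ⟨h.compl_right_subset hz hw, hwz⟩
  refine Summable.tsum_lt_tsum (i := n) (fun k => ?_) ?_ (hsum z) (hsum y)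
  · exact mul_le_mul_of_nonneg_left (infDist_le_infDist_of_subset hsub (hne y)) (by positivity)
  · refine mul_lt_mul_of_pos_left ?_ (by positivity)
    rw [infDist_zero_of_mem (show d n ∈ (Q z)ᶜ from
      fun hw => (h.disjoint z).le_bot ⟨hn2, hw⟩)]
    exact ((h.isOpen_right y).isClosed_compl.notMem_iff_infDist_pos (hne y)).1 (not_not.2 hn1)

theorem exists_parametrization (h : IsCutSystem p q P Q) (hpq : p ≠ q) :
    ∃ g : X → ℝ, Continuous g ∧ Function.Injective g ∧ g p = 0 ∧ g q = 1 ∧ range g = Icc 0 1 := by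
  have : Nonempty X := ⟨p⟩
  obtain ⟨f, hf, hlt⟩ := h.exists_strictAnti
  have hinj : Function.Injective f := by
    intro y z hyz
    by_contra hne
    rcases h.mem_or_mem (Ne.symm hne) with hz | hz
    · exact (hlt z y (h.mem_left_iff.1 hz)).ne hyz
    · exact (hlt y z hz).ne' hyz
  have hle1 : ∀ y, f y ≤ f p := fun y => by
    by_cases hy : y = p
    · rw [hy]
    · exact (hlt p y (h.mem_left_iff.1
        ((h.mem_or_mem (Ne.symm hy)).resolve_right (h.notMem_right y)))).le
  have hle2 : ∀ y, f q ≤ f y := fun y => by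
    by_cases hy : y = q
    · rw [hy]
    · exact (hlt y q ((h.mem_or_mem (Ne.symm hy)).resolve_left (h.notMem_left y))).le
  have hpos : 0 < f p - f q := sub_pos.2 ((hle1 q).lt_of_ne fun e => hpq (hinj e.symm))
  set g : X → ℝ := fun y => (f p - f y) / (f p - f q) with hg
  have hgc : Continuous g := (continuous_const.sub hf).div_const _
  have hgp : g p = 0 := by simp [hg]
  have hgq : g q = 1 := div_self hpos.ne'
  refine ⟨g, hgc, fun y z hyz => hinj ?_, hgp, hgq, Subset.antisymm ?_ ?_⟩
  · have := (div_left_inj' hpos.ne').1 hyz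
    linarith
  · rintro _ ⟨y, rfl⟩
    exact ⟨div_nonneg (by linarith [hle1 y]) hpos.le, (div_le_one hpos).2 (by linarith [hle2 y])⟩
  · have := intermediate_value_univ p q hgc
    rwa [hgp, hgq] at this

end IsCutSystem

section Pairs

variable {X : Type*} [TopologicalSpace X]

/-- Two pairs of points, each separating the space, separate each other. -/
theorem not_mem_and_mem_of_union_eq_compl_pair (hX : ∀ p : X, IsPreconnected ({p}ᶜ : Set X))
    {A B M N : Set X} {p q y b : X} (hA : IsOpen A) (hB : IsOpen B) (hAB : Disjoint A B)
    (hABu : A ∪ B = {p, q}ᶜ) (hy : y ∈ A) (hb : b ∈ B) (hM : IsOpen M) (hN : IsOpen N)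
    (hMN : Disjoint M N) (hMNu : M ∪ N = {y, b}ᶜ) (hNne : N.Nonempty) : ¬(p ∈ M ∧ q ∈ M) := by
  rintro ⟨hpM, hqM⟩
  have key : ∀ {A B : Set X} {y b : X}, IsOpen A → IsOpen B → Disjoint A B → A ∪ B = {p, q}ᶜ →
      y ∈ A → b ∈ B → M ∪ N = {y, b}ᶜ → N ∩ A = ∅ := by
    intro A B y b hA hB hAB hABu hy hb hMNu
    have hpy : p ≠ y := by
      rintro rfl
      exact (hABu.subset (Or.inl hy)) (Or.inl rfl)
    have hd : Disjoint (N ∩ A) (M ∪ B) := by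
      rw [disjoint_left]
      rintro z ⟨hzN, hzA⟩ (hz | hz)
      · exact hMN.le_bot ⟨hz, hzN⟩
      · exact hAB.le_bot ⟨hzA, hz⟩
    have hsub := (hX y).subset_right_of_subset_union (hN.inter hA) (hM.union hB) hd (fun z hz => by
      by_cases hzM : z ∈ M
      · exact Or.inr (Or.inl hzM)
      by_cases hzB : z ∈ B
      · exact Or.inr (Or.inr hzB)
      have hzN : z ∈ N := by
        have : z ∈ M ∪ N := by
          rw [hMNu]
          rintro (h | h)
          · exact hz h
          · exact hzB (mem_singleton_iff.1 h ▸ hb)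
        exact this.resolve_left hzM
      have hzA : z ∈ A := by
        have : z ∈ A ∪ B := by
          rw [hABu]
          rintro (h | h)
          · exact hzM (h ▸ hpM)
          · exact hzM (mem_singleton_iff.1 h ▸ hqM)
        exact this.resolve_right hzB
      exact Or.inl ⟨hzN, hzA⟩) ⟨p, hpy, Or.inl hpM⟩
    refine eq_empty_of_forall_notMem fun z hz => hd.le_bot ⟨hz, hsub ?_⟩
    rintro rfl
    exact (hMNu.subset (Or.inr hz.1)) (Or.inl rfl)
  have h1 := key hA hB hAB hABu hy hb hMNu
  have h2 := key hB hA hAB.symm (by rw [union_comm, hABu]) hb hy (by rw [hMNu, pair_comm])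
  obtain ⟨z, hz⟩ := hNne
  have : z ∈ A ∪ B := by
    rw [hABu]
    rintro (h | h)
    · exact hMN.le_bot ⟨h ▸ hpM, hz⟩
    · exact hMN.le_bot ⟨mem_singleton_iff.1 h ▸ hqM, hz⟩
  rcases this with h | h
  · exact h1.subset ⟨hz, h⟩
  · exact h2.subset ⟨hz, h⟩

theorem isPreconnected_compl_of_union_eq_compl_pair [PreconnectedSpace X]
    (hX : ∀ p : X, IsPreconnected ({p}ᶜ : Set X)) {A B : Set X} {p q : X} (hA : IsOpen A)
    (hB : IsOpen B) (hAB : Disjoint A B) (hABu : A ∪ B = {p, q}ᶜ) (hAne : A.Nonempty)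
    (hpq : p ≠ q) : IsPreconnected Bᶜ := by
  have hpA : p ∉ A := fun h => hABu.subset (Or.inl h) (Or.inl rfl)
  have hqA : q ∉ A := fun h => hABu.subset (Or.inl h) (Or.inr rfl)
  have hpB : p ∈ Bᶜ := fun h => hABu.subset (Or.inr h) (Or.inl rfl)
  have hqB : q ∈ Bᶜ := fun h => hABu.subset (Or.inr h) (Or.inr rfl)
  have hmem : ∀ z, z ≠ p → z ≠ q → z ∉ B → z ∈ A := fun z h1 h2 h3 => by
    have : z ∈ A ∪ B := by
      rw [hABu]
      rintro (h | h)
      exacts [h1 h, h2 h]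
    exact this.resolve_right h3
  have same : ∀ u v : Set X, IsClosed u → IsClosed v → Bᶜ ⊆ u ∪ v → Disjoint u v → p ∈ u → q ∈ u →
      Bᶜ ⊆ u := by
    intro u v hu hv huv hd hp hq
    have h1 : (univ : Set X) ⊆ B ∪ vᶜ := by
      refine isPreconnected_univ.subset_right_of_subset_union (u := A ∩ uᶜ)
        (hA.inter hu.isOpen_compl) (hB.union hv.isOpen_compl) ?_ ?_ ⟨p, trivial, Or.inr ?_⟩
      · rw [disjoint_left]
        rintro z ⟨hzA, hzu⟩ (hz | hz)
        · exact hAB.le_bot ⟨hzA, hz⟩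
        · exact hz ((huv fun hzB => hAB.le_bot ⟨hzA, hzB⟩).resolve_left hzu)
      · intro z _
        by_cases hzB : z ∈ B
        · exact Or.inr (Or.inl hzB)
        by_cases hzv : z ∈ v
        · refine Or.inl ⟨hmem z ?_ ?_ hzB, fun hzu => hd.le_bot ⟨hzu, hzv⟩⟩
          · rintro rfl; exact hd.le_bot ⟨hp, hzv⟩
          · rintro rfl; exact hd.le_bot ⟨hq, hzv⟩
        · exact Or.inr (Or.inr hzv)
      · exact fun h => hd.le_bot ⟨hp, h⟩
    exact fun z hz => (huv hz).resolve_right ((h1 trivial).resolve_left hz)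
  have diff : ∀ (u v : Set X) (p q : X), (∀ z, z ≠ p → z ≠ q → z ∉ B → z ∈ A) → p ∉ A → q ∉ A →
      q ∈ Bᶜ → p ≠ q → IsClosed u →
      IsClosed v → Bᶜ ⊆ u ∪ v → Disjoint u v → p ∈ u → q ∈ v → A ∩ u = ∅ := by
    intro u v p q hmem hpA hqA hqB hpq hu hv huv hd hp hq
    have hdis : Disjoint (A ∩ vᶜ) (B ∪ uᶜ) := by
      rw [disjoint_left]
      rintro z ⟨hzA, hzv⟩ (hz | hz)
      · exact hAB.le_bot ⟨hzA, hz⟩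
      · exact hz ((huv fun hzB => hAB.le_bot ⟨hzA, hzB⟩).resolve_right hzv)
    have h1 : ({p}ᶜ : Set X) ⊆ B ∪ uᶜ := by
      refine (hX p).subset_right_of_subset_union
        (hA.inter hv.isOpen_compl) (hB.union hu.isOpen_compl) hdis ?_ ⟨q, hpq.symm, Or.inr ?_⟩
      · intro z hz
        by_cases hzB : z ∈ B
        · exact Or.inr (Or.inl hzB)
        by_cases hzu : z ∈ u
        · refine Or.inl ⟨hmem z hz ?_ hzB, fun hzv => hd.le_bot ⟨hzu, hzv⟩⟩
          rintro rfl; exact hd.le_bot ⟨hzu, hq⟩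
        · exact Or.inr (Or.inr hzu)
      · exact fun h => hd.le_bot ⟨h, hq⟩
    refine eq_empty_of_forall_notMem fun z ⟨hzA, hzu⟩ => ?_
    rcases h1 (show z ∈ ({p}ᶜ : Set X) from fun h => hpA (mem_singleton_iff.1 h ▸ hzA)) with h | h
    · exact hAB.le_bot ⟨hzA, h⟩
    · exact h hzu
  rw [isPreconnected_iff_subset_of_fully_disjoint_closed hB.isClosed_compl]
  intro u v hu hv huv hd
  have hvu : Bᶜ ⊆ v ∪ u := by rwa [union_comm]
  have hmem' : ∀ z, z ≠ q → z ≠ p → z ∉ B → z ∈ A := fun z h1 h2 => hmem z h2 h1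
  have contra : A ∩ u = ∅ → A ∩ v = ∅ → False := fun h1 h2 => by
    obtain ⟨z, hz⟩ := hAne
    rcases huv (fun hzB => hAB.le_bot ⟨hz, hzB⟩ : z ∈ Bᶜ) with h | h
    · exact h1.subset ⟨hz, h⟩
    · exact h2.subset ⟨hz, h⟩
  rcases huv hpB with hp | hp <;> rcases huv hqB with hq | hq
  · exact Or.inl (same u v hu hv huv hd hp hq)
  · exact (contra (diff u v p q hmem hpA hqA hqB hpq hu hv huv hd hp hq)
      (diff v u q p hmem' hqA hpA hpB hpq.symm hv hu hvu hd.symm hq hp)).elim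
  · exact (contra (diff u v q p hmem' hqA hpA hpB hpq.symm hu hv huv hd hq hp)
      (diff v u p q hmem hpA hqA hqB hpq hv hu hvu hd.symm hp hq)).elim
  · exact Or.inr (same v u hv hu hvu hd.symm hp hq)

end Pairs

/-- The closed arc cut off by a separating pair of points is parametrized by `[0, 1]`. -/
theorem exists_parametrization_of_union_eq_compl_pair {X : Type*} [MetricSpace X] [CompactSpace X]
    [PreconnectedSpace X] (hX : ∀ p : X, IsPreconnected ({p}ᶜ : Set X))
    (hX' : ∀ x y : X, x ≠ y → ∃ M N : Set X, IsOpen M ∧ IsOpen N ∧ Disjoint M N ∧ M.Nonempty ∧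
      N.Nonempty ∧ M ∪ N = {x, y}ᶜ) {A B : Set X} {p q : X} (hA : IsOpen A)
    (hB : IsOpen B) (hAB : Disjoint A B) (hABu : A ∪ B = {p, q}ᶜ) (hAne : A.Nonempty)
    (hBne : B.Nonempty) (hpq : p ≠ q) :
    ∃ g : X → ℝ, ContinuousOn g Bᶜ ∧ InjOn g Bᶜ ∧ g p = 0 ∧ g q = 1 ∧ g '' Bᶜ = Icc 0 1 := by
  have hpB : p ∈ Bᶜ := fun h => hABu.subset (Or.inr h) (Or.inl rfl)
  have hqB : q ∈ Bᶜ := fun h => hABu.subset (Or.inr h) (Or.inr rfl)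
  have hK := isPreconnected_compl_of_union_eq_compl_pair hX hA hB hAB hABu hAne hpq
  have : PreconnectedSpace ↥Bᶜ := Subtype.preconnectedSpace hK
  have : CompactSpace ↥Bᶜ := isCompact_iff_compactSpace.1 hB.isClosed_compl.isCompact
  have hex : ∀ y : ↥Bᶜ, ∃ P Q : Set ↥Bᶜ, IsOpen P ∧ IsOpen Q ∧ Disjoint P Q ∧ P ∪ Q = {y}ᶜ ∧
      ⟨q, hqB⟩ ∉ P ∧ ⟨p, hpB⟩ ∉ Q := by
    rintro ⟨y, hy⟩
    by_cases hyp : y = p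
    · subst hyp
      exact ⟨∅, {⟨y, hy⟩}ᶜ, isOpen_empty, isOpen_compl_singleton, empty_disjoint _, empty_union _,
        notMem_empty _, fun h => h rfl⟩
    by_cases hyq : y = q
    · subst hyq
      exact ⟨{⟨y, hy⟩}ᶜ, ∅, isOpen_compl_singleton, isOpen_empty, disjoint_empty _, union_empty _,
        fun h => h rfl, notMem_empty _⟩
    have hyA : y ∈ A := by
      have : y ∈ A ∪ B := by
        rw [hABu]
        rintro (h | h)
        exacts [hyp h, hyq h]
      exact this.resolve_right hy
    obtain ⟨b, hb⟩ := hBne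
    have hyb : y ≠ b := fun h => hy (h ▸ hb)
    obtain ⟨M, N, hM, hN, hMN, hMne, hNne, hMNu⟩ := hX' y b hyb
    have hp : p ∈ M ∪ N := by
      rw [hMNu]
      rintro (h | h)
      exacts [hyp h.symm, hpB (mem_singleton_iff.1 h ▸ hb)]
    have hq : q ∈ M ∪ N := by
      rw [hMNu]
      rintro (h | h)
      exacts [hyq h.symm, hqB (mem_singleton_iff.1 h ▸ hb)]
    have hNM : N ∪ M = {y, b}ᶜ := by rwa [union_comm]
    have h1 := not_mem_and_mem_of_union_eq_compl_pair hX hA hB hAB hABu hyA hb hM hN hMN hMNu hNne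
    have h2 := not_mem_and_mem_of_union_eq_compl_pair hX hA hB hAB hABu hyA hb hN hM hMN.symm hNM
      hMne
    have key : ∀ {M N : Set X}, IsOpen M → IsOpen N → Disjoint M N → M ∪ N = {y, b}ᶜ → p ∈ M →
        q ∈ N → ∃ P Q : Set ↥Bᶜ, IsOpen P ∧ IsOpen Q ∧ Disjoint P Q ∧ P ∪ Q = {⟨y, hy⟩}ᶜ ∧
      ⟨q, hqB⟩ ∉ P ∧ ⟨p, hpB⟩ ∉ Q := by
      intro M N hM hN hMN hMNu hpM hqN
      refine ⟨Subtype.val ⁻¹' M, Subtype.val ⁻¹' N, hM.preimage continuous_subtype_val,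
        hN.preimage continuous_subtype_val, hMN.preimage _, ?_, fun h => hMN.le_bot ⟨h, hqN⟩,
        fun h => hMN.le_bot ⟨hpM, h⟩⟩
      rw [← preimage_union, hMNu]
      ext ⟨z, hz⟩
      constructor
      · intro h h'
        exact h (Or.inl (congrArg Subtype.val h'))
      · rintro h (h' | h')
        · exact h (Subtype.ext h')
        · exact hz ((show z = b from h') ▸ hb)
    rcases hp with hp | hp <;> rcases hq with hq | hq
    · exact (h1 ⟨hp, hq⟩).elim
    · exact key hM hN hMN hMNu hp hq
    · exact key hN hM hMN.symm hNM hp hq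
    · exact (h2 ⟨hp, hq⟩).elim
  choose P Q hP hQ hPQ hPQu hqP hpQ using hex
  have hcut : IsCutSystem (⟨p, hpB⟩ : ↥Bᶜ) ⟨q, hqB⟩ P Q := ⟨hP, hQ, hPQ, hPQu, hqP, hpQ⟩
  obtain ⟨g, hg, hinj, hgp, hgq, hr⟩ := hcut.exists_parametrization
    (fun h => hpq (congrArg Subtype.val h))
  have hval : ∀ z : ↥Bᶜ, Function.extend Subtype.val g 0 z = g z := fun z =>
    Subtype.val_injective.extend_apply g 0 z
  refine ⟨Function.extend Subtype.val g 0, ?_, ?_, ?_, ?_, ?_⟩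
  · rw [continuousOn_iff_continuous_domRestrict]
    exact hg.congr fun z => (hval z).symm
  · intro y hy z hz h
    have := hinj ((hval ⟨y, hy⟩).symm.trans (h.trans (hval ⟨z, hz⟩)))
    exact congrArg Subtype.val this
  · exact (hval ⟨p, hpB⟩).trans hgp
  · exact (hval ⟨q, hqB⟩).trans hgq
  · rw [← hr]
    ext t
    constructor
    · rintro ⟨z, hz, rfl⟩
      exact ⟨⟨z, hz⟩, (hval ⟨z, hz⟩).symm⟩
    · rintro ⟨z, rfl⟩
      exact ⟨z, z.2, hval z⟩

/-- A compact connected metric space that no point but every pair of points disconnects is a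
circle. -/
theorem nonempty_homeomorph_sphere {X : Type*} [MetricSpace X] [CompactSpace X]
    [PreconnectedSpace X] [Nontrivial X] (hX : ∀ p : X, IsPreconnected ({p}ᶜ : Set X))
    (hX' : ∀ x y : X, x ≠ y → ∃ M N : Set X, IsOpen M ∧ IsOpen N ∧ Disjoint M N ∧ M.Nonempty ∧
      N.Nonempty ∧ M ∪ N = {x, y}ᶜ) : Nonempty (X ≃ₜ ↥(sphere (0 : ℂ) 1)) := by
  obtain ⟨p, q, hpq⟩ := exists_pair_ne X
  obtain ⟨A, B, hA, hB, hAB, hAne, hBne, hABu⟩ := hX' p q hpq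
  obtain ⟨f, hfc, hfi, hfp, hfq, hfr⟩ := exists_parametrization_of_union_eq_compl_pair hX hX' hA hB
    hAB hABu hAne hBne hpq
  obtain ⟨g, hgc, hgi, hgp, hgq, hgr⟩ := exists_parametrization_of_union_eq_compl_pair hX hX' hB hA
    hAB.symm (by rwa [union_comm]) hBne hAne hpq
  have hpA : p ∈ Aᶜ := fun h => hABu.subset (Or.inl h) (Or.inl rfl)
  have hqA : q ∈ Aᶜ := fun h => hABu.subset (Or.inl h) (Or.inr rfl)
  have hpB : p ∈ Bᶜ := fun h => hABu.subset (Or.inr h) (Or.inl rfl)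
  have hqB : q ∈ Bᶜ := fun h => hABu.subset (Or.inr h) (Or.inr rfl)
  have hcov : Bᶜ ∪ Aᶜ = univ := by
    rw [← compl_inter, inter_comm, hAB.inter_eq, compl_empty]
  have hpair : ∀ z, z ∈ Bᶜ → z ∈ Aᶜ → z = p ∨ z = q := fun z h1 h2 => by
    by_contra h
    have : z ∈ A ∪ B := by rw [hABu]; exact h
    exact this.elim h2 h1
  have hfI : ∀ z ∈ Bᶜ, f z ∈ Icc (0 : ℝ) 1 := fun z hz => hfr ▸ mem_image_of_mem f hz
  have hgI : ∀ z ∈ Aᶜ, g z ∈ Icc (0 : ℝ) 1 := fun z hz => hgr ▸ mem_image_of_mem g hz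
  classical
  set h : X → ℝ := fun z => if z ∈ Bᶜ then Real.pi * f z else -(Real.pi * g z) with hh
  set Φ : X → ℂ := fun z => Complex.exp (h z * Complex.I) with hΦ
  have hΦB : ∀ z ∈ Bᶜ, Φ z = Complex.exp ((Real.pi * f z : ℝ) * Complex.I) := fun z hz => by
    simp only [hΦ, hh, if_pos hz]
  have hΦA : ∀ z ∈ Aᶜ, Φ z = Complex.exp ((-(Real.pi * g z) : ℝ) * Complex.I) := by
    intro z hz
    by_cases hzB : z ∈ Bᶜ
    · rw [hΦB z hzB]
      rcases hpair z hzB hz with rfl | rfl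
      · simp [hfp, hgp]
      · simp [hfq, hgq, Complex.exp_neg, Complex.exp_pi_mul_I]
    · simp only [hΦ, hh, if_neg hzB]
  have hΦc : Continuous Φ := by
    rw [← continuousOn_univ, ← hcov]
    refine ContinuousOn.union_of_isClosed ?_ ?_ hB.isClosed_compl hA.isClosed_compl
    · refine ContinuousOn.congr ?_ hΦB
      fun_prop
    · refine ContinuousOn.congr ?_ hΦA
      fun_prop
  have hrange : ∀ z, h z ∈ Ioc (-Real.pi) Real.pi := by
    intro z
    by_cases hz : z ∈ Bᶜ
    · have := hfI z hz
      simp only [hh, if_pos hz]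
      exact ⟨by nlinarith [Real.pi_pos, this.1], by nlinarith [Real.pi_pos, this.2]⟩
    · have hzA : z ∈ Aᶜ := fun hzA => hAB.le_bot ⟨hzA, not_not.1 hz⟩
      have := hgI z hzA
      have h1 : g z ≠ 1 := fun e => hz (hgi hzA hqA (e.trans hgq.symm) ▸ hqB)
      have h2 : g z < 1 := this.2.lt_of_ne h1
      simp only [hh, if_neg hz]
      exact ⟨by nlinarith [Real.pi_pos], by nlinarith [Real.pi_pos, this.1]⟩
  have hinj : Function.Injective Φ := by
    intro y z hyz
    have hyz' : h y = h z := by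
      have harg : ∀ z, (Φ z).arg = h z := fun z => by
        simp only [hΦ]
        rw [Complex.exp_mul_I, Complex.arg_cos_add_sin_mul_I (hrange z)]
      rw [← harg, hyz, harg]
    have hneg : ∀ z ∉ Bᶜ, h z < 0 := fun z hz => by
      have hzA : z ∈ Aᶜ := fun hzA => hAB.le_bot ⟨hzA, not_not.1 hz⟩
      have h1 : g z ≠ 0 := fun e => hz (hgi hzA hpA (e.trans hgp.symm) ▸ hpB)
      simp only [hh, if_neg hz]
      have := mul_pos Real.pi_pos ((hgI z hzA).1.lt_of_ne h1.symm)
      linarith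
    have hnn : ∀ z ∈ Bᶜ, 0 ≤ h z := fun z hz => by
      simp only [hh, if_pos hz]
      exact mul_nonneg Real.pi_pos.le (hfI z hz).1
    by_cases hy : y ∈ Bᶜ <;> by_cases hz : z ∈ Bᶜ
    · simp only [hh, if_pos hy, if_pos hz] at hyz'
      exact hfi hy hz (mul_left_cancel₀ Real.pi_ne_zero hyz')
    · linarith [hneg z hz, hnn y hy]
    · linarith [hneg y hy, hnn z hz]
    · simp only [hh, if_neg hy, if_neg hz] at hyz'
      exact hgi (fun hyA => hAB.le_bot ⟨hyA, not_not.1 hy⟩)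
        (fun hzA => hAB.le_bot ⟨hzA, not_not.1 hz⟩)
        (mul_left_cancel₀ Real.pi_ne_zero (neg_injective hyz'))
  have hsph : ∀ z, Φ z ∈ sphere (0 : ℂ) 1 := fun z => by
    rw [mem_sphere_zero_iff_norm]
    exact Complex.norm_exp_ofReal_mul_I _
  have hsurj : ∀ w ∈ sphere (0 : ℂ) 1, ∃ z, Φ z = w := by
    intro w hw
    rw [mem_sphere_zero_iff_norm] at hw
    have hwe : Complex.exp (w.arg * Complex.I) = w := by
      have := Complex.norm_mul_exp_arg_mul_I w
      rwa [hw, Complex.ofReal_one, one_mul] at this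
    have hpi := Real.pi_pos
    rcases le_total 0 w.arg with h0 | h0
    · obtain ⟨z, hz, hzf⟩ := hfr.superset (show w.arg / Real.pi ∈ Icc (0 : ℝ) 1 from
        ⟨div_nonneg h0 hpi.le, (div_le_one hpi).2 w.arg_le_pi⟩)
      refine ⟨z, ?_⟩
      rw [hΦB z hz, hzf, mul_div_cancel₀ _ hpi.ne', hwe]
    · obtain ⟨z, hz, hzg⟩ := hgr.superset (show -w.arg / Real.pi ∈ Icc (0 : ℝ) 1 from
        ⟨div_nonneg (neg_nonneg.2 h0) hpi.le, (div_le_one hpi).2 (by linarith [w.neg_pi_lt_arg])⟩)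
      refine ⟨z, ?_⟩
      rw [hΦA z hz, hzg, mul_div_cancel₀ _ hpi.ne', neg_neg, hwe]
  set e : X ≃ ↥(sphere (0 : ℂ) 1) := Equiv.ofBijective (fun z => ⟨Φ z, hsph z⟩)
    ⟨fun y z hyz => hinj (congrArg Subtype.val hyz), fun w => by
      obtain ⟨z, hz⟩ := hsurj w w.2
      exact ⟨z, Subtype.ext hz⟩⟩
  exact ⟨Continuous.homeoOfEquivCompactToT2 (f := e) (hΦc.subtype_mk hsph)⟩

theorem locallyConnectedSpace_sphere : LocallyConnectedSpace ↥(sphere (0 : ℂ) 1) := by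
  have : Fact (Module.finrank ℝ ℂ = 1 + 1) := ⟨Complex.finrank_real_complex⟩
  exact ChartedSpace.locallyConnectedSpace (EuclideanSpace ℝ (Fin 1)) ↥(sphere (0 : ℂ) 1)

namespace SimplyConnectedAtBoundary

variable {Ω : Set ℂ}

theorem isPreconnected_compl_singleton (H : SimplyConnectedAtBoundary Ω) (hΩo : IsOpen Ω)
    (hΩc : IsConnected Ω) (hb : Bornology.IsBounded Ω) {x₀ : ℂ}
    (p : ↥(connectedComponentIn (frontier Ω) x₀)) :
    IsPreconnected ({p}ᶜ : Set ↥(connectedComponentIn (frontier Ω) x₀)) := by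
  refine isPreconnected_of_forall_pair fun a ha b hb' => ?_
  by_cases hab : a = b
  · subst hab
    exact ⟨{a}, singleton_subset_iff.2 ha, rfl, rfl, isPreconnected_singleton⟩
  have haQ := connectedComponentIn_eq a.2
  obtain ⟨F, Z, Z', -, hF, -, hZF, hZ', hZZ, hZc, hZc', haZ, hbZ, haZ', hbZ'⟩ :=
    H.exists_side hΩo hΩc hb (connectedComponentIn_subset _ _ a.2)
      (fun h => hab (Subtype.ext h)) (haQ ▸ b.2)
  have key : ∀ T : Set ℂ, IsPreconnected T → T ⊆ frontier Ω → (a : ℂ) ∈ T → (b : ℂ) ∈ T →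
      (p : ℂ) ∉ T → ∃ t ⊆ {p}ᶜ, a ∈ t ∧ b ∈ t ∧ IsPreconnected t := by
    intro T hT hTK haT hbT hpT
    refine ⟨Subtype.val ⁻¹' T, fun z hz h => hpT (h ▸ hz), haT, hbT, ?_⟩
    rw [← Topology.IsInducing.subtypeVal.isPreconnected_image, Subtype.image_preimage_coe,
      inter_eq_self_of_subset_right]
    · exact hT
    · rw [haQ]
      exact hT.subset_connectedComponentIn haT hTK
  by_cases hp : (p : ℂ) ∈ Z
  · refine key Z' hZc' hZ' haZ' hbZ' fun hp' => ?_
    rcases hZZ ⟨hp', hZF hp⟩ with h | h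
    · exact ha (Subtype.ext h.symm)
    · exact hb' (Subtype.ext (mem_singleton_iff.1 h).symm)
  · exact key Z hZc (hZF.trans hF) haZ hbZ hp

theorem exists_separation (H : SimplyConnectedAtBoundary Ω) (hΩo : IsOpen Ω)
    (hΩc : IsConnected Ω) (hb : Bornology.IsBounded Ω) {x₀ : ℂ}
    {x y : ↥(connectedComponentIn (frontier Ω) x₀)} (hxy : x ≠ y) :
    ∃ F : Set ℂ, IsClosed F ∧ IsClosed (frontier Ω \ F ∪ {(x : ℂ), (y : ℂ)}) ∧ (x : ℂ) ∈ F ∧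
      (y : ℂ) ∈ F ∧
      ∃ M N : Set ↥(connectedComponentIn (frontier Ω) x₀), IsOpen M ∧ IsOpen N ∧ Disjoint M N ∧
        M.Nonempty ∧ N.Nonempty ∧ M ∪ N = {x, y}ᶜ ∧ Subtype.val '' M ⊆ F ∧
        Disjoint (Subtype.val '' N) F := by
  have hne : (x : ℂ) ≠ y := fun h => hxy (Subtype.ext h)
  have hxQ := connectedComponentIn_eq x.2
  obtain ⟨F, Z, Z', hFc, hF, hGc, hZF, hZ', hZZ, hZc, hZc', hxZ, hyZ, hxZ', hyZ'⟩ :=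
    H.exists_side hΩo hΩc hb (connectedComponentIn_subset _ _ x.2) hne (hxQ ▸ y.2)
  have third : ∀ T : Set ℂ, IsPreconnected T → T ⊆ frontier Ω → (x : ℂ) ∈ T → (y : ℂ) ∈ T →
      ∃ z : ↥(connectedComponentIn (frontier Ω) x₀), (z : ℂ) ∈ T ∧ (z : ℂ) ≠ x ∧ (z : ℂ) ≠ y := by
    intro T hT hTK hxT hyT
    have hinf := hT.infinite_of_nontrivial ⟨x, hxT, y, hyT, hne⟩
    obtain ⟨z, hz, hzn⟩ := (hinf.sdiff (toFinite {(x : ℂ), (y : ℂ)})).nonempty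
    have hzQ : z ∈ connectedComponentIn (frontier Ω) x₀ := by
      rw [hxQ]
      exact hT.subset_connectedComponentIn hxT hTK hz
    exact ⟨⟨z, hzQ⟩, hz, fun h => hzn (Or.inl h), fun h => hzn (Or.inr h)⟩
  have hKQ := connectedComponentIn_subset (frontier Ω) x₀
  refine ⟨F, hFc, hGc, hZF hxZ, hZF hyZ,
    Subtype.val ⁻¹' (frontier Ω \ F ∪ {(x : ℂ), (y : ℂ)})ᶜ, Subtype.val ⁻¹' Fᶜ,
    hGc.isOpen_compl.preimage continuous_subtype_val,
    hFc.isOpen_compl.preimage continuous_subtype_val, ?_, ?_, ?_, ?_, ?_, ?_⟩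
  · rw [disjoint_left]
    intro z hz hzF
    exact hz (Or.inl ⟨hKQ z.2, hzF⟩)
  · obtain ⟨z, hz, h1, h2⟩ := third Z hZc (hZF.trans hF) hxZ hyZ
    refine ⟨z, ?_⟩
    rintro (h | h | h)
    exacts [h.2 (hZF hz), h1 h, h2 h]
  · obtain ⟨z, hz, h1, h2⟩ := third Z' hZc' hZ' hxZ' hyZ'
    refine ⟨z, fun h => ?_⟩
    rcases hZZ ⟨hz, h⟩ with h | h
    exacts [h1 h, h2 h]
  · ext z
    constructor
    · rintro (h | h) (h' | h')
      · exact h (Or.inr (Or.inl (congrArg Subtype.val h')))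
      · exact h (Or.inr (Or.inr (congrArg Subtype.val (mem_singleton_iff.1 h'))))
      · exact h (h' ▸ hZF hxZ)
      · exact h (mem_singleton_iff.1 h' ▸ hZF hyZ)
    · intro h
      by_cases hz : (z : ℂ) ∈ F
      · refine Or.inl ?_
        rintro (h' | h' | h')
        · exact h'.2 hz
        · exact h (Or.inl (Subtype.ext h'))
        · exact h (Or.inr (Subtype.ext h'))
      · exact Or.inr hz
  · rintro _ ⟨z, hz, rfl⟩
    by_contra hzF
    exact hz (Or.inl ⟨hKQ z.2, hzF⟩)
  · rw [disjoint_left]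
    rintro _ ⟨z, hz, rfl⟩
    exact hz

theorem eq_singleton_or_homeomorph (H : SimplyConnectedAtBoundary Ω) (hΩo : IsOpen Ω)
    (hΩc : IsConnected Ω) (hb : Bornology.IsBounded Ω) {x : ℂ} (hx : x ∈ frontier Ω) :
    connectedComponentIn (frontier Ω) x = {x} ∨
      Nonempty (↥(connectedComponentIn (frontier Ω) x) ≃ₜ ↥(sphere (0 : ℂ) 1)) := by
  have hxQ := mem_connectedComponentIn hx
  by_cases hQ : (connectedComponentIn (frontier Ω) x).Nontrivial
  · right
    have : Nontrivial ↥(connectedComponentIn (frontier Ω) x) := nontrivial_coe_sort.2 hQ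
    have : PreconnectedSpace ↥(connectedComponentIn (frontier Ω) x) :=
      Subtype.preconnectedSpace isPreconnected_connectedComponentIn
    have : CompactSpace ↥(connectedComponentIn (frontier Ω) x) := by
      refine isCompact_iff_compactSpace.1 ?_
      exact (isCompact_of_isClosed_isBounded isClosed_frontier
        (hb.closure.subset frontier_subset_closure)).of_isClosed_subset
        (isClosed_connectedComponentIn isClosed_frontier x) (connectedComponentIn_subset _ _)
    refine nonempty_homeomorph_sphere (H.isPreconnected_compl_singleton hΩo hΩc hb) ?_
    intro a b hab
    obtain ⟨-, -, -, -, -, M, N, h1, h2, h3, h4, h5, h6, -⟩ :=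
      H.exists_separation hΩo hΩc hb hab
    exact ⟨M, N, h1, h2, h3, h4, h5, h6⟩
  · left
    exact (not_nontrivial_iff.1 hQ).eq_singleton_of_mem hxQ

theorem finite_setOf_lt_diam (H : SimplyConnectedAtBoundary Ω) (hΩo : IsOpen Ω)
    (hΩc : IsConnected Ω) (hb : Bornology.IsBounded Ω) {C : ℝ} (hC : 0 < C) :
    {Q | (∃ x ∈ frontier Ω, Q = connectedComponentIn (frontier Ω) x) ∧ C < diam Q}.Finite := by
  have hK : IsCompact (frontier Ω) := isCompact_of_isClosed_isBounded isClosed_frontier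
    (hb.closure.subset frontier_subset_closure)
  by_contra hinf
  set Q : ℕ → Set ℂ := fun n => (Set.Infinite.natEmbedding _ hinf n : Set ℂ) with hQ
  have hQi : Function.Injective Q := fun m n h =>
    (Set.Infinite.natEmbedding _ hinf).injective (Subtype.ext h)
  have hQp : ∀ n, (∃ x ∈ frontier Ω, Q n = connectedComponentIn (frontier Ω) x) ∧ C < diam (Q n) :=
    fun n => (Set.Infinite.natEmbedding _ hinf n).2
  have hQK : ∀ n, Q n ⊆ frontier Ω := fun n => by
    obtain ⟨⟨x, -, h⟩, -⟩ := hQp n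
    rw [h]
    exact connectedComponentIn_subset _ _
  have hQc : ∀ n, IsPreconnected (Q n) := fun n => by
    obtain ⟨⟨x, -, h⟩, -⟩ := hQp n
    rw [h]
    exact isPreconnected_connectedComponentIn
  have hQe : ∀ n, ∀ z ∈ Q n, Q n = connectedComponentIn (frontier Ω) z := fun n z hz => by
    obtain ⟨⟨x, -, h⟩, -⟩ := hQp n
    rw [h] at hz ⊢
    exact connectedComponentIn_eq hz
  have hfar : ∀ n, ∃ a ∈ Q n, ∃ b ∈ Q n, C < dist a b := fun n => by
    by_contra! h
    exact (hQp n).2.not_ge (diam_le_of_forall_dist_le hC.le h)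
  choose a ha b hb' hab using hfar
  obtain ⟨⟨x, y⟩, ⟨hx, hy⟩, φ, hφ, hlim⟩ := (hK.prod hK).tendsto_subseq
    (x := fun n => (a n, b n)) fun n => ⟨hQK n (ha n), hQK n (hb' n)⟩
  have hax : Tendsto (fun n => a (φ n)) atTop (𝓝 x) := (continuous_fst.tendsto _).comp hlim
  have hby : Tendsto (fun n => b (φ n)) atTop (𝓝 y) := (continuous_snd.tendsto _).comp hlim
  have hne : x ≠ y := by
    rintro rfl
    have := ge_of_tendsto (hax.dist hby) (Eventually.of_forall fun n => (hab (φ n)).le)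
    rw [dist_self] at this
    linarith
  have hsame : y ∈ connectedComponentIn (frontier Ω) x := by
    by_contra hyn
    obtain ⟨W, hWK, hW, hKW, hxW, hyW⟩ := exists_isClosed_disjoint_of_connectedComponentIn hK hx
      (isClosed_singleton (x := y)) (disjoint_singleton_left.2 hyn)
    have h1 : ∀ᶠ n in atTop, a (φ n) ∈ (frontier Ω \ W)ᶜ :=
      hax (hKW.isOpen_compl.mem_nhds fun h => h.2 hxW)
    have h2 : ∀ᶠ n in atTop, b (φ n) ∈ Wᶜ :=
      hby (hW.isOpen_compl.mem_nhds (disjoint_singleton_right.1 hyW))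
    obtain ⟨n, hn1, hn2⟩ := (h1.and h2).exists
    have haW : a (φ n) ∈ W := by
      by_contra h
      exact hn1 ⟨hQK _ (ha _), h⟩
    obtain ⟨z, -, hz1, hz2⟩ := isPreconnected_closed_iff.1 (hQc (φ n)) W (frontier Ω \ W) hW hKW
      (fun z hz => by
        by_cases h : z ∈ W
        · exact Or.inl h
        · exact Or.inr ⟨hQK _ hz, h⟩) ⟨_, ha _, haW⟩ ⟨_, hb' _, hQK _ (hb' _), hn2⟩
    exact hz2.2 hz1
  set x' : ↥(connectedComponentIn (frontier Ω) x) := ⟨x, mem_connectedComponentIn hx⟩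
  set y' : ↥(connectedComponentIn (frontier Ω) x) := ⟨y, hsame⟩
  have hxy' : x' ≠ y' := fun h => hne (congrArg Subtype.val h)
  obtain ⟨-, -, -, -, -, A, B, hA, hB, hAB, ⟨z, hz⟩, ⟨w, hw⟩, hABu, -⟩ :=
    H.exists_separation hΩo hΩc hb hxy'
  have hzw : z ≠ w := by
    rintro rfl
    exact hAB.le_bot ⟨hz, hw⟩
  obtain ⟨F, hF, hG, hzF, hwF, M, N, hM, hN, hMN, hMne, hNne, hMNu, hMF, hNF⟩ :=
    H.exists_separation hΩo hΩc hb hzw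
  have hX := H.isPreconnected_compl_singleton hΩo hΩc hb (x₀ := x)
  have hmem : ∀ u, u = x' ∨ u = y' → u ∈ M ∪ N := by
    intro u hu
    rw [hMNu]
    have hu' : u ∉ A ∪ B := by
      rw [hABu]
      exact not_not.2 hu
    rintro (h | h)
    · exact hu' (Or.inl (h ▸ hz))
    · exact hu' (Or.inr (mem_singleton_iff.1 h ▸ hw))
  have h1 := not_mem_and_mem_of_union_eq_compl_pair hX hA hB hAB hABu hz hw hM hN hMN hMNu hNne
  have h2 := not_mem_and_mem_of_union_eq_compl_pair hX hA hB hAB hABu hz hw hN hM hMN.symm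
    (by rwa [union_comm]) hMne
  set G : Set ℂ := frontier Ω \ F ∪ {(z : ℂ), (w : ℂ)} with hGdef
  have hFG : ∀ u ∈ F ∩ G, u ∈ connectedComponentIn (frontier Ω) x := by
    rintro u ⟨huF, h | h | h⟩
    · exact (h.2 huF).elim
    · exact h ▸ z.2
    · exact mem_singleton_iff.1 h ▸ w.2
  have key : ∀ (c d : ℕ → ℂ) (s t : ↥(connectedComponentIn (frontier Ω) x)),
      (∀ n, c n ∈ Q n) → (∀ n, d n ∈ Q n) → Tendsto (fun n => c (φ n)) atTop (𝓝 s) →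
      Tendsto (fun n => d (φ n)) atTop (𝓝 t) → s ∈ M → t ∈ N → False := by
    intro c d s t hc hd hcs hdt hs ht
    have hsG : (s : ℂ) ∉ G := by
      rintro (h | h)
      · exact h.2 (hMF (mem_image_of_mem _ hs))
      · have : s ∈ ({z, w} : Set _) := h.imp (fun h => Subtype.ext h) fun h => Subtype.ext h
        exact hMNu.subset (Or.inl hs) this
    have htF : (t : ℂ) ∉ F := fun h => hNF.le_bot ⟨mem_image_of_mem _ ht, h⟩
    have e1 : ∀ᶠ n in atTop, c (φ n) ∈ Gᶜ := hcs (hG.isOpen_compl.mem_nhds hsG)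
    have e2 : ∀ᶠ n in atTop, d (φ n) ∈ Fᶜ := hdt (hF.isOpen_compl.mem_nhds htF)
    have e3 : ∀ᶠ n in atTop, Q (φ n) ≠ connectedComponentIn (frontier Ω) x := by
      by_cases hex : ∃ m, Q (φ m) = connectedComponentIn (frontier Ω) x
      · obtain ⟨m, hm⟩ := hex
        filter_upwards [eventually_gt_atTop m] with n hn h
        exact hn.ne (hφ.injective (hQi (hm.trans h.symm)))
      · exact Eventually.of_forall (not_exists.1 hex)
    obtain ⟨n, hn1, hn2, hn3⟩ := (e1.and (e2.and e3)).exists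
    have hcov : Q (φ n) ⊆ F ∪ G := fun u hu => by
      by_cases huF : u ∈ F
      · exact Or.inl huF
      · exact Or.inr (Or.inl ⟨hQK _ hu, huF⟩)
    obtain ⟨u, huQ, hu⟩ := isPreconnected_closed_iff.1 (hQc (φ n)) F G hF hG hcov
      ⟨_, hc _, (hcov (hc _)).resolve_right hn1⟩ ⟨_, hd _, (hcov (hd _)).resolve_left hn2⟩
    exact hn3 ((hQe _ u huQ).trans (connectedComponentIn_eq (hFG u hu)).symm)
  rcases hmem x' (Or.inl rfl) with hx' | hx' <;> rcases hmem y' (Or.inr rfl) with hy' | hy'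
  · exact h1 ⟨hx', hy'⟩
  · exact key a b x' y' ha hb' hax hby hx' hy'
  · exact key b a y' x' hb' ha hby hax hy' hx'
  · exact h2 ⟨hx', hy'⟩

end SimplyConnectedAtBoundary

/-- A bounded domain is simply connected at the boundary iff it is a generalized
Jordan domain. -/
theorem stmt_9 (Ω : Set ℂ) (hΩ : IsPlanarDomain Ω) (hb : Bornology.IsBounded Ω) :
    (∀ x ∈ frontier Ω, ∀ r > (0:ℝ), ∃ U : Set ℂ,
      IsOpen U ∧ x ∈ U ∧ U ⊆ Metric.ball x r ∧ IsConnected (U ∩ Ω)) ↔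
    IsGeneralizedJordanDomain Ω := by
  constructor
  · intro H
    have H' : SimplyConnectedAtBoundary Ω := H
    obtain ⟨-, hΩo, hΩc⟩ := hΩ
    have hcomp := fun x (hx : x ∈ frontier Ω) => H'.eq_singleton_or_homeomorph hΩo hΩc hb hx
    refine ⟨⟨hΩc.nonempty, hΩo, hΩc⟩, hb, ⟨isCompact_of_isClosed_isBounded isClosed_frontier
      (hb.closure.subset frontier_subset_closure), fun x hx => ?_,
      fun C hC => H'.finite_setOf_lt_diam hΩo hΩc hb hC⟩, hcomp⟩
    rcases hcomp x hx with h | ⟨⟨e⟩⟩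
    · rw [h]
      infer_instance
    · have := locallyConnectedSpace_sphere
      exact e.isOpenEmbedding.locallyConnectedSpace
  · rintro ⟨-, -, ⟨-, -, hfin⟩, hJ⟩ x hx r hr
    exact exists_isConnected_inter_of_connectedComponentIn_frontier hΩ.2.1 hΩ.2.2.isPreconnected hb
      hr (hJ x hx) hfin hx
end
end

section
/- Let D ⊆ ℂ be a generalized Jordan domain and let φ : D → Ω be a homeomorphism of D onto a bounded domain Ω ⊆ ℂ. If φ admits a continuous extension φ̄ : closure(D) → closure(Ω), then ∂Ω is a Peano compactum and liminf_{r→0⁺} σ_r(z₀) = 0 for every z₀ ∈ ∂D. -/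
open Set Metric Filter MeasureTheory Topology

noncomputable section

/-- In a compact set of the plane, two points in different components are separated by a
continuous function on the plane which only takes the values `0` and `1` on the set. -/
theorem exists_continuous_separating_components {K : Set ℂ} (hK : IsCompact K) {z z' : ℂ}
    (hz : z ∈ K) (hz' : z' ∈ K) (h : z' ∉ connectedComponentIn K z) :
    ∃ u : C(ℂ, ℝ), (∀ x ∈ K, u x = 0 ∨ u x = 1) ∧ u z ≠ u z' := by
  have : CompactSpace K := isCompact_iff_compactSpace.mp hK
  have h1 : (⟨z', hz'⟩ : K) ∉ connectedComponent (⟨z, hz⟩ : K) := by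
    intro h2
    exact h (by rw [connectedComponentIn_eq_image hz]; exact ⟨_, h2, rfl⟩)
  rw [connectedComponent_eq_iInter_isClopen] at h1
  simp only [mem_iInter, not_forall, Subtype.exists] at h1
  obtain ⟨s, ⟨hs, hzs⟩, hz's⟩ := h1
  have hA : IsClosed ((↑) '' s : Set ℂ) :=
    (hs.isClosed.isCompact.image continuous_subtype_val).isClosed
  have hB : IsClosed ((↑) '' sᶜ : Set ℂ) :=
    (hs.compl.isClosed.isCompact.image continuous_subtype_val).isClosed
  obtain ⟨u, hu0, hu1, -⟩ := exists_continuous_zero_one_of_isClosed hA hB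
    (disjoint_image_of_injective Subtype.val_injective disjoint_compl_right)
  refine ⟨u, fun x hx => ?_, ?_⟩
  · by_cases hxs : (⟨x, hx⟩ : K) ∈ s
    · exact .inl (hu0 ⟨_, hxs, rfl⟩)
    · exact .inr (hu1 ⟨_, hxs, rfl⟩)
  · have e0 : u z = 0 := hu0 ⟨_, hzs, rfl⟩
    have e1 : u z' = 1 := hu1 ⟨_, hz's, rfl⟩
    rw [e0, e1]
    exact zero_ne_one

/-- A continuous real function taking only integer values on a preconnected set is constant
there. -/
theorem IsPreconnected.eq_of_forall_coe_addCircle_eq_zero {S : Set ℂ} (hS : IsPreconnected S)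
    {g : ℂ → ℝ} (hg : ContinuousOn g S) (h : ∀ x ∈ S, (g x : AddCircle (1 : ℝ)) = 0)
    {x y : ℂ} (hx : x ∈ S) (hy : y ∈ S) : g x = g y := by
  refine hS.constant_of_mapsTo (T := range ((↑) : ℤ → ℝ))
    Int.isClosedEmbedding_coe_real.isEmbedding.isDiscrete_range hg ?_ hx hy
  intro x hx
  obtain ⟨n, hn⟩ := AddCircle.coe_eq_zero_iff (1 : ℝ) |>.mp (h x hx)
  exact ⟨n, by simpa using hn⟩

section BoundaryCorrespondence

variable {D Ω : Set ℂ} {φ φb : ℂ → ℂ}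

theorem ExtendsContinuously.image_closure (hDb : Bornology.IsBounded D)
    (hφ : IsHomeoOnto φ D Ω) (hext : ExtendsContinuously φ φb D Ω) :
    φb '' closure D = closure Ω := by
  obtain ⟨hc, heq, hmaps⟩ := hext
  refine hmaps.image_subset.antisymm ?_
  refine closure_minimal ?_ (hDb.isCompact_closure.image_of_continuousOn hc).isClosed
  rw [← hφ.2.1.image_eq, ← heq.image_eq]
  exact image_mono subset_closure

theorem ExtendsContinuously.notMem_of_mem_frontier (hD : IsOpen D) (hΩ : IsOpen Ω)
    (hφ : IsHomeoOnto φ D Ω) (hext : ExtendsContinuously φ φb D Ω) {z : ℂ}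
    (hz : z ∈ frontier D) : φb z ∉ Ω := by
  obtain ⟨hc, heq, -⟩ := hext
  obtain ⟨-, hbij, ψ, hψ, hinv⟩ := hφ
  intro hy
  rw [hD.frontier_eq] at hz
  have : (𝓝[D] z).NeBot := mem_closure_iff_nhdsWithin_neBot.mp hz.1
  have h1 : Tendsto φb (𝓝[D] z) (𝓝 (φb z)) := (hc z hz.1).mono subset_closure
  have h2 : Tendsto (fun x => ψ (φb x)) (𝓝[D] z) (𝓝 (ψ (φb z))) :=
    (hψ.continuousAt (hΩ.mem_nhds hy)).tendsto.comp h1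
  have h3 : Tendsto (fun x => ψ (φb x)) (𝓝[D] z) (𝓝 z) := by
    refine Tendsto.congr' ?_ (tendsto_id.mono_left nhdsWithin_le_nhds)
    filter_upwards [self_mem_nhdsWithin] with x hx
    rw [heq hx, hinv.1 hx, id]
  have h4 : z = ψ (φb z) := tendsto_nhds_unique h3 h2
  obtain ⟨x, hx, hxy⟩ := hbij.surjOn hy
  rw [← hxy, hinv.1 hx] at h4
  exact hz.2 (h4 ▸ hx)

theorem ExtendsContinuously.image_frontier (hD : IsOpen D) (hDb : Bornology.IsBounded D)
    (hΩ : IsOpen Ω) (hφ : IsHomeoOnto φ D Ω) (hext : ExtendsContinuously φ φb D Ω) :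
    φb '' frontier D = frontier Ω := by
  rw [hΩ.frontier_eq]
  refine Subset.antisymm ?_ ?_
  · rintro _ ⟨z, hz, rfl⟩
    exact ⟨hext.2.2 hz.1, hext.notMem_of_mem_frontier hD hΩ hφ hz⟩
  · rintro y ⟨hy, hyΩ⟩
    rw [← hext.image_closure hDb hφ] at hy
    obtain ⟨z, hz, rfl⟩ := hy
    refine ⟨z, ?_, rfl⟩
    rw [hD.frontier_eq]
    refine ⟨hz, fun hzD => hyΩ ?_⟩
    rw [hext.2.1 hzD]
    exact hφ.2.1.mapsTo hzD

/-- A function on the closure of `D` which vanishes modulo `1` on the boundary of `D` descends,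
up to an additive constant, to a continuous function on the plane. The function modulo `1`
extends by `0` outside `Ω`, and this extension lifts to `ℝ` as the plane is simply connected. -/
theorem ExtendsContinuously.exists_continuous_descend (hD : IsOpen D) (hDc : IsPreconnected D)
    (hDb : Bornology.IsBounded D) (hΩ : IsOpen Ω)
    (hφ : IsHomeoOnto φ D Ω) (hext : ExtendsContinuously φ φb D Ω) (u : C(ℂ, ℝ))
    (hu : ∀ z ∈ frontier D, u z = 0 ∨ u z = 1) :
    ∃ w : C(ℂ, ℝ), ∀ z ∈ closure D, w (φb z) = u z := by
  classical
  obtain ⟨ψ, -, hinv⟩ := hφ.2.2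
  let v : ℂ → AddCircle (1 : ℝ) := fun x => if x ∈ Ω then (u (ψ x) : AddCircle (1 : ℝ)) else 0
  have hv : ∀ z ∈ closure D, v (φb z) = (u z : AddCircle (1 : ℝ)) := by
    intro z hz
    by_cases hzD : z ∈ D
    · have : φ z ∈ Ω := hφ.2.1.mapsTo hzD
      simp only [v, hext.2.1 hzD, this, if_true]
      rw [hinv.1 hzD]
    · have hzf : z ∈ frontier D := by rw [hD.frontier_eq]; exact ⟨hz, hzD⟩
      simp only [v, hext.notMem_of_mem_frontier hD hΩ hφ hzf, if_false]
      rcases hu z hzf with h | h <;> rw [h]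
      · simp
      · exact (AddCircle.coe_period 1).symm
  have hcoe : Continuous ((↑) : ℝ → AddCircle (1 : ℝ)) := AddCircle.continuous_mk' 1
  have hv1 : ContinuousOn v (closure Ω) := by
    have : CompactSpace (closure D) := isCompact_iff_compactSpace.mp hDb.isCompact_closure
    let q : closure D → closure Ω := hext.2.2.restrict
    have hq : Continuous q := hext.1.mapsToRestrict hext.2.2
    have hqs : Function.Surjective q := by
      rintro ⟨y, hy⟩
      rw [← hext.image_closure hDb hφ] at hy
      obtain ⟨z, hz, rfl⟩ := hy
      exact ⟨⟨z, hz⟩, rfl⟩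
    rw [continuousOn_iff_continuous_domRestrict,
      (hq.isClosedMap.isQuotientMap hq hqs).continuous_iff]
    have : (closure Ω).domRestrict v ∘ q = fun z : closure D => (u z : AddCircle (1 : ℝ)) :=
      funext fun z => hv z z.2
    rw [this]
    exact hcoe.comp (u.continuous.comp continuous_subtype_val)
  have hv2 : ContinuousOn v Ωᶜ :=
    continuousOn_const.congr fun x hx => if_neg hx
  have hvc : Continuous v := by
    rw [← continuousOn_univ]
    have := hv1.union_of_isClosed hv2 isClosed_closure hΩ.isClosed_compl
    refine this.mono fun x _ => ?_
    by_cases hx : x ∈ Ω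
    · exact .inl (subset_closure hx)
    · exact .inr hx
  obtain ⟨e, he⟩ := QuotientAddGroup.mk_surjective (v 0)
  obtain ⟨w, ⟨-, hw⟩, -⟩ :=
    (AddCircle.isCoveringMap_coe (1 : ℝ)).existsUnique_continuousMap_lifts ⟨v, hvc⟩ 0 e he
  have hw' : ∀ x, (w x : AddCircle (1 : ℝ)) = v x := fun x => congrFun hw x
  rcases (closure D).eq_empty_or_nonempty with h0 | ⟨z₀, hz₀⟩
  · exact ⟨w, by simp [h0]⟩
  refine ⟨w - .const ℂ (w (φb z₀) - u z₀), fun z hz => ?_⟩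
  have key := hDc.closure.eq_of_forall_coe_addCircle_eq_zero (g := fun z => w (φb z) - u z)
    ((w.continuous.comp_continuousOn hext.1).sub u.continuous.continuousOn)
    (fun x hx => by rw [AddCircle.coe_sub, hw', hv x hx, sub_self]) hz hz₀
  simp only [ContinuousMap.sub_apply, ContinuousMap.const_apply]
  linarith

/-- Boundary points of `D` with images in the same boundary component of `Ω` lie in the same
boundary component of `D`. -/
theorem ExtendsContinuously.mem_connectedComponentIn (hD : IsOpen D) (hDc : IsPreconnected D)
    (hDb : Bornology.IsBounded D) (hΩ : IsOpen Ω)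
    (hφ : IsHomeoOnto φ D Ω) (hext : ExtendsContinuously φ φb D Ω) {z z' : ℂ}
    (hz : z ∈ frontier D) (hz' : z' ∈ frontier D)
    (h : φb z' ∈ connectedComponentIn (frontier Ω) (φb z)) :
    z' ∈ connectedComponentIn (frontier D) z := by
  by_contra hcon
  obtain ⟨u, hu, huz⟩ := exists_continuous_separating_components
    (hDb.isCompact_closure.of_isClosed_subset isClosed_frontier frontier_subset_closure)
    hz hz' hcon
  obtain ⟨w, hw⟩ := hext.exists_continuous_descend hD hDc hDb hΩ hφ u hu
  have himg := hext.image_frontier hD hDb hΩ hφ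
  apply huz
  rw [← hw z hz.1, ← hw z' hz'.1]
  refine isPreconnected_connectedComponentIn.eq_of_forall_coe_addCircle_eq_zero
    (S := connectedComponentIn (frontier Ω) (φb z)) w.continuous.continuousOn ?_
    (_root_.mem_connectedComponentIn (himg ▸ mem_image_of_mem _ hz)) h
  intro x hx
  have hx' := connectedComponentIn_subset _ _ hx
  rw [← himg] at hx'
  obtain ⟨t, ht, rfl⟩ := hx'
  rw [hw t ht.1]
  rcases hu t ht with h | h <;> rw [h]
  · simp
  · exact AddCircle.coe_period 1

theorem ExtendsContinuously.image_connectedComponentIn (hD : IsOpen D) (hDc : IsPreconnected D)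
    (hDb : Bornology.IsBounded D) (hΩ : IsOpen Ω)
    (hφ : IsHomeoOnto φ D Ω) (hext : ExtendsContinuously φ φb D Ω) {z : ℂ}
    (hz : z ∈ frontier D) :
    φb '' connectedComponentIn (frontier D) z = connectedComponentIn (frontier Ω) (φb z) := by
  have himg := hext.image_frontier hD hDb hΩ hφ
  refine Subset.antisymm ?_ fun y hy => ?_
  · rw [← himg]
    exact (hext.1.mono frontier_subset_closure).image_connectedComponentIn_subset hz
  · have hy' := connectedComponentIn_subset _ _ hy
    rw [← himg] at hy'
    obtain ⟨t, ht, rfl⟩ := hy'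
    exact ⟨t, hext.mem_connectedComponentIn hD hDc hDb hΩ hφ hz ht hy, rfl⟩

end BoundaryCorrespondence

theorem IsCompact.locallyConnectedSpace_image {K : Set ℂ} (hK : IsCompact K)
    [LocallyConnectedSpace K] {f : ℂ → ℂ} (hf : ContinuousOn f K) :
    LocallyConnectedSpace ↥(f '' K) := by
  have : CompactSpace K := isCompact_iff_compactSpace.mp hK
  have hq : Continuous ((mapsTo_image f K).restrict) := hf.mapsToRestrict (mapsTo_image f K)
  have hqs : Function.Surjective (mapsTo_image f K).restrict := by
    rintro ⟨_, z, hz, rfl⟩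
    exact ⟨⟨z, hz⟩, rfl⟩
  exact (hq.isClosedMap.isQuotientMap hq hqs).locallyConnectedSpace

theorem IsCompact.connectedComponentIn {K : Set ℂ} (hK : IsCompact K) (z : ℂ) :
    IsCompact (connectedComponentIn K z) := by
  have : CompactSpace K := isCompact_iff_compactSpace.mp hK
  by_cases hz : z ∈ K
  · rw [connectedComponentIn_eq_image hz]
    exact isClosed_connectedComponent.isCompact.image continuous_subtype_val
  · rw [connectedComponentIn_eq_empty hz]
    exact isCompact_empty

/-- A map continuous on a compact set sends small subsets to sets of small diameter. -/
theorem IsCompact.exists_diam_image_le {K : Set ℂ} (hK : IsCompact K) {f : ℂ → ℂ}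
    (hf : ContinuousOn f K) {C : ℝ} (hC : 0 < C) :
    ∃ δ > 0, ∀ Q ⊆ K, Metric.diam Q ≤ δ → Metric.diam (f '' Q) ≤ C := by
  obtain ⟨δ, hδ, h⟩ := Metric.uniformContinuousOn_iff.mp
    (hK.uniformContinuousOn_of_continuous hf) C hC
  refine ⟨δ / 2, half_pos hδ, fun Q hQ hdiam => ?_⟩
  refine Metric.diam_le_of_forall_dist_le hC.le ?_
  rintro _ ⟨x, hx, rfl⟩ _ ⟨y, hy, rfl⟩
  refine (h x (hQ hx) y (hQ hy) ?_).le
  have := Metric.dist_le_diam_of_mem (hK.isBounded.subset hQ) hx hy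
  linarith

/-- Necessity: a continuous extension forces a Peano compactum boundary and
vanishing liminf of oscillations. -/
theorem stmt_10 (D Ω : Set ℂ) (φ φb : ℂ → ℂ)
    (hD : IsGeneralizedJordanDomain D)
    (hΩ : IsPlanarDomain Ω) (hΩb : Bornology.IsBounded Ω)
    (hφ : IsHomeoOnto φ D Ω)
    (hext : ExtendsContinuously φ φb D Ω) :
    IsPeanoCompactum (frontier Ω) ∧ ∀ z₀ ∈ frontier D, OscLiminfZero φ D z₀ := by
  obtain ⟨⟨-, hDo, hDc⟩, hDb, ⟨hKc, hKl, hKf⟩, -⟩ := hD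
  have hΩo := hΩ.2.1
  have himg := hext.image_frontier hDo hDb hΩo hφ
  have hcomp := fun z hz => hext.image_connectedComponentIn hDo hDc.isPreconnected hDb hΩo hφ
    (z := z) hz
  have hcont : ContinuousOn φb (frontier D) := hext.1.mono frontier_subset_closure
  refine ⟨⟨himg ▸ hKc.image_of_continuousOn hcont, ?_, ?_⟩, ?_⟩
  · intro x hx
    rw [← himg] at hx
    obtain ⟨z, hz, rfl⟩ := hx
    rw [← hcomp z hz]
    have := hKl z hz
    exact (hKc.connectedComponentIn z).locallyConnectedSpace_image
      (hcont.mono (connectedComponentIn_subset _ _))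
  · intro C hC
    obtain ⟨δ, hδ, hd⟩ := hKc.exists_diam_image_le hcont hC
    refine ((hKf δ hδ).image (φb '' ·)).subset ?_
    rintro _ ⟨⟨x, hx, rfl⟩, hQ⟩
    rw [← himg] at hx
    obtain ⟨z, hz, rfl⟩ := hx
    rw [← hcomp z hz] at hQ ⊢
    refine ⟨_, ⟨⟨z, hz, rfl⟩, ?_⟩, rfl⟩
    by_contra! hle
    exact (hd _ (connectedComponentIn_subset _ _) hle).not_gt hQ
  · intro z₀ _
    refine Tendsto.liminf_eq (Metric.tendsto_nhds.mpr fun ε hε => ?_)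
    obtain ⟨δ, hδ, hd⟩ := hDb.isCompact_closure.exists_diam_image_le hext.1 (half_pos hε)
    filter_upwards [Ioo_mem_nhdsGT (half_pos hδ)] with r hr
    have hle : Metric.diam (D ∩ sphere z₀ r) ≤ δ := by
      have h1 : Metric.diam (D ∩ sphere z₀ r) ≤ 2 * r :=
        (Metric.diam_mono (inter_subset_right.trans sphere_subset_closedBall)
          Metric.isBounded_closedBall).trans (Metric.diam_closedBall hr.1.le)
      linarith [hr.2]
    have := hd _ (inter_subset_left.trans subset_closure) hle
    rw [(hext.2.1.mono inter_subset_left).image_eq] at this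
    rw [Real.dist_eq, sub_zero, oscDiam, abs_of_nonneg Metric.diam_nonneg]
    linarith
end
end
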